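/- arXiv:1510.06467 — 6 statements merged into one kernel-verified Lean document; each statement's English description precedes it below -/
import Mathlib

section
/- Let Φ = {φ_j}_{j=1}^N be a nonlattice self-similar system on ℝ^m with attractor F and scaling vector r. Then there exists a sequence (Φ_M)_{M≥1} of lattice self-similar systems on ℝ^m, with scaling vectors r_M and attractors F_M, such that as M → ∞: (i) r_M → r componentwise, and (ii) F_M → F in the Hausdorff metric, i.e., the Hausdorff distance between F_M and F tends to 0. -/
open Filter Topology Metric

/-- A scaling vector is *lattice* if its components are powers `ρ ^ (k j)` of a common
ratio `ρ ∈ (0,1)` with positive integer exponents whose gcd is `1`. -/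
def IsLatticeVec {N : ℕ} (r : Fin N → ℝ) : Prop :=
  ∃ (ρ : ℝ) (k : Fin N → ℕ), ρ ∈ Set.Ioo (0 : ℝ) 1 ∧ (∀ j, 0 < k j) ∧
    Finset.univ.gcd k = 1 ∧ ∀ j, r j = ρ ^ (k j)

/-- `φ` is a contracting similarity with scaling ratio `ρ`. -/
def IsSimilarity {X : Type*} [MetricSpace X] (φ : X → X) (ρ : ℝ) : Prop :=
  ∀ x y, dist (φ x) (φ y) = ρ * dist x y

/-- `F` is the attractor of the self-similar system `φ`: the (unique) nonempty compact set
invariant under the system. -/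
def IsAttractor {X : Type*} [MetricSpace X] {N : ℕ} (φ : Fin N → X → X) (F : Set X) : Prop :=
  F.Nonempty ∧ IsCompact F ∧ F = ⋃ j, φ j '' F

/-- A Lipschitz map expands the Hausdorff distance at most by its Lipschitz constant. -/
theorem LipschitzWith.hausdorffEDist_image_le {X Y : Type*} [PseudoEMetricSpace X]
    [PseudoEMetricSpace Y] {K : NNReal} {f : X → Y} (hf : LipschitzWith K f)
    {s t : Set X} (hs : s.Nonempty) (ht : t.Nonempty) :
    hausdorffEDist (f '' s) (f '' t) ≤ K * hausdorffEDist s t := by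
  have key : ∀ {u v : Set X}, v.Nonempty → ∀ y ∈ f '' u,
      infEDist y (f '' v) ≤ K * hausdorffEDist u v := by
    rintro u v hv _ ⟨x, hx, rfl⟩
    have : Nonempty v := hv.to_subtype
    calc infEDist (f x) (f '' v) ≤ ⨅ z : v, (K : ENNReal) * edist x z :=
          le_iInf fun z => (infEDist_le_edist_of_mem (Set.mem_image_of_mem f z.2)).trans (hf _ _)
      _ = K * ⨅ z : v, edist x z :=
          (ENNReal.mul_iInf fun h => (ENNReal.coe_ne_top h).elim).symm
      _ = K * infEDist x v := by rw [infEDist, iInf_subtype']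
      _ ≤ K * hausdorffEDist u v := by
          gcongr
          exact infEDist_le_hausdorffEDist_of_mem hx
  refine hausdorffEDist_le_of_infEDist (key ht) fun y hy => ?_
  rw [hausdorffEDist_comm]
  exact key hs y hy

/-- A finite system of uniform contractions of a complete metric space has an attractor, which is
close to the attractor of any system that is uniformly close to it on that set. -/
theorem exists_isAttractor_hausdorffDist_le {X : Type*} [MetricSpace X] [CompleteSpace X] {N : ℕ}
    {φ ψ : Fin N → X → X} {F : Set X} (hF : IsAttractor φ F) {K : NNReal} (hK : K < 1)
    (hψ : ∀ j, LipschitzWith K (ψ j)) {ε : ℝ} (hε : 0 ≤ ε)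
    (hφψ : ∀ j, ∀ x ∈ F, dist (φ j x) (ψ j x) ≤ ε) :
    ∃ A, IsAttractor ψ A ∧ hausdorffDist A F ≤ ε / (1 - K) := by
  obtain ⟨hne, hcpt, hinv⟩ := hF
  have hN : Nonempty (Fin N) := by
    obtain ⟨x, hx⟩ := hne
    rw [hinv] at hx
    exact ⟨(Set.mem_iUnion.1 hx).choose⟩
  let F' : TopologicalSpace.NonemptyCompacts X := ⟨⟨F, hcpt⟩, hne⟩
  have : Nonempty (TopologicalSpace.NonemptyCompacts X) := ⟨F'⟩
  let T : TopologicalSpace.NonemptyCompacts X → TopologicalSpace.NonemptyCompacts X := fun s =>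
    ⟨⟨⋃ j, ψ j '' s, isCompact_iUnion fun j => s.isCompact.image (hψ j).continuous⟩,
      Set.nonempty_iUnion.2 ⟨hN.some, s.nonempty.image _⟩⟩
  have hT : ContractingWith K T := ⟨hK, fun s t => hausdorffEDist_iUnion_le.trans
    (iSup_le fun j => (hψ j).hausdorffEDist_image_le s.nonempty t.nonempty)⟩
  refine ⟨(hT.fixedPoint T : TopologicalSpace.NonemptyCompacts X),
    ⟨TopologicalSpace.NonemptyCompacts.nonempty _,
    TopologicalSpace.NonemptyCompacts.isCompact _,
    (congrArg SetLike.coe hT.fixedPoint_isFixedPt).symm⟩, ?_⟩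
  have hK' : (0 : ℝ) < 1 - K := sub_pos.2 (by exact_mod_cast hK)
  have hFT : dist F' (T F') ≤ ε := by
    refine hausdorffDist_le_of_mem_dist hε (fun x hx => ?_) fun y hy => ?_
    · have hx' : x ∈ ⋃ j, φ j '' F := hinv ▸ hx
      obtain ⟨j, z, hz, rfl⟩ := Set.mem_iUnion.1 hx'
      exact ⟨ψ j z, Set.mem_iUnion.2 ⟨j, z, hz, rfl⟩, hφψ j z hz⟩
    · obtain ⟨j, z, hz, rfl⟩ := Set.mem_iUnion.1 hy
      exact ⟨φ j z, hinv.ge (Set.mem_iUnion.2 ⟨j, z, hz, rfl⟩), by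
        rw [dist_comm]; exact hφψ j z hz⟩
  calc hausdorffDist (hT.fixedPoint T : TopologicalSpace.NonemptyCompacts X) F
        = dist F' (hT.fixedPoint T) := hausdorffDist_comm
    _ ≤ dist F' (T F') / (1 - K) := hT.dist_fixedPoint_le F'
    _ ≤ ε / (1 - K) := by gcongr

/-- Positive powers of a common ratio form a lattice scaling vector, whatever the gcd of the
exponents. -/
theorem isLatticeVec_pow {N : ℕ} [NeZero N] {ρ : ℝ} (hρ : ρ ∈ Set.Ioo (0 : ℝ) 1) {k : Fin N → ℕ}
    (hk : ∀ j, 0 < k j) : IsLatticeVec fun j => ρ ^ k j := by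
  obtain ⟨l, hl, hgcd⟩ := Finset.extract_gcd k (Finset.univ_nonempty (α := Fin N))
  have hpos : ∀ j, 0 < Finset.univ.gcd k * l j := fun j => hl j (Finset.mem_univ j) ▸ hk j
  have hg : Finset.univ.gcd k ≠ 0 := (Nat.pos_of_mul_pos_right (hpos 0)).ne'
  refine ⟨ρ ^ Finset.univ.gcd k, l, ⟨pow_pos hρ.1 _, pow_lt_one₀ hρ.1.le hρ.2 hg⟩,
    fun j => Nat.pos_of_mul_pos_left (hpos j), hgcd, fun j => ?_⟩
  rw [← pow_mul, ← hl j (Finset.mem_univ j)]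

/-- Every scaling vector is a componentwise limit of lattice scaling vectors, from below. -/
theorem exists_isLatticeVec_tendsto {N : ℕ} [NeZero N] {r : Fin N → ℝ}
    (hr : ∀ j, r j ∈ Set.Ioo (0 : ℝ) 1) :
    ∃ R : ℕ → Fin N → ℝ, (∀ M, IsLatticeVec (R M)) ∧ (∀ M j, 0 < R M j) ∧
      (∀ M j, R M j ≤ r j) ∧ ∀ j, Tendsto (fun M => R M j) atTop (𝓝 (r j)) := by
  have hlog : ∀ j, 0 < -Real.log (r j) := fun j =>
    neg_pos.2 (Real.log_neg (hr j).1 (hr j).2)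
  have hM : ∀ M : ℕ, (0 : ℝ) < M + 1 := fun M => by positivity
  let k : ℕ → Fin N → ℕ := fun M j => ⌈-Real.log (r j) * (M + 1)⌉₊
  have hR : ∀ (M : ℕ) j, Real.exp (-(1 / ((M : ℝ) + 1))) ^ k M j
      = Real.exp (-((k M j : ℝ) / ((M : ℝ) + 1))) := fun (M : ℕ) j => by
    rw [← Real.exp_nat_mul]
    congr 1
    ring
  refine ⟨fun M j => Real.exp (-(1 / ((M : ℝ) + 1))) ^ k M j, fun M => isLatticeVec_pow
    ⟨Real.exp_pos _, Real.exp_lt_one_iff.2 (neg_neg_of_pos (one_div_pos.2 (hM M)))⟩ fun j =>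
      Nat.ceil_pos.2 (mul_pos (hlog j) (hM M)), fun M j => pow_pos (Real.exp_pos _) _,
    fun M j => ?_, fun j => ?_⟩
  · change Real.exp _ ^ k M j ≤ r j
    rw [hR, ← Real.le_log_iff_exp_le (hr j).1, neg_le, le_div_iff₀ (hM M)]
    exact Nat.le_ceil _
  · simp only [hR]
    have h : Tendsto (fun M : ℕ => (k M j : ℝ) / ((M : ℝ) + 1)) atTop (𝓝 (-Real.log (r j))) :=
      (tendsto_nat_ceil_mul_div_atTop (hlog j).le).comp
        (tendsto_atTop_add_const_right _ 1 tendsto_natCast_atTop_atTop)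
    simpa [Function.comp_def, Real.exp_log (hr j).1] using (Real.continuous_exp.tendsto _).comp h.neg

/-- A nonlattice self-similar system on `ℝ^m` is approximated by lattice self-similar systems:
the scaling vectors converge componentwise and the attractors converge in the Hausdorff
metric. -/
theorem stmt1 {m N : ℕ} (hN : 2 ≤ N)
    (φ : Fin N → EuclideanSpace ℝ (Fin m) → EuclideanSpace ℝ (Fin m))
    (r : Fin N → ℝ) (hr : ∀ j, r j ∈ Set.Ioo (0 : ℝ) 1)
    (hsim : ∀ j, IsSimilarity (φ j) (r j))
    (F : Set (EuclideanSpace ℝ (Fin m))) (hF : IsAttractor φ F)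
    (hnl : ¬ IsLatticeVec r) :
    ∃ (Φ : ℕ → Fin N → EuclideanSpace ℝ (Fin m) → EuclideanSpace ℝ (Fin m))
      (R : ℕ → Fin N → ℝ) (FM : ℕ → Set (EuclideanSpace ℝ (Fin m))),
      (∀ M j, R M j ∈ Set.Ioo (0 : ℝ) 1) ∧
      (∀ M j, IsSimilarity (Φ M j) (R M j)) ∧
      (∀ M, IsLatticeVec (R M)) ∧
      (∀ M, IsAttractor (Φ M) (FM M)) ∧
      (∀ j, Tendsto (fun M => R M j) atTop (𝓝 (r j))) ∧
      Tendsto (fun M => hausdorffDist (FM M) F) atTop (𝓝 0) := by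
  have : NeZero N := ⟨by omega⟩
  obtain ⟨R, hlat, hpos, hle, hlim⟩ := exists_isLatticeVec_tendsto hr
  let Φ : ℕ → Fin N → EuclideanSpace ℝ (Fin m) → EuclideanSpace ℝ (Fin m) :=
    fun M j x => φ j 0 + (R M j / r j) • (φ j x - φ j 0)
  have hΦ : ∀ M j, IsSimilarity (Φ M j) (R M j) := fun M j x y => by
    have hrj := (hr j).1
    rw [dist_add_left, dist_smul₀, dist_sub_right, hsim j, Real.norm_of_nonneg
      (div_nonneg (hpos M j).le hrj.le), ← mul_assoc, div_mul_cancel₀ _ hrj.ne']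
  obtain ⟨i, -, hi⟩ := Finset.exists_max_image Finset.univ r Finset.univ_nonempty
  let K : NNReal := ⟨r i, (hr i).1.le⟩
  have hlip : ∀ M j, LipschitzWith K (Φ M j) := fun M j =>
    LipschitzWith.of_dist_le_mul fun x y => by
      rw [hΦ M j]
      exact mul_le_mul_of_nonneg_right ((hle M j).trans (hi j (Finset.mem_univ j))) dist_nonneg
  obtain ⟨C, hC0, hC⟩ := hF.2.1.isBounded.exists_pos_norm_le
  have hclose : ∀ M j, ∀ x ∈ F, dist (φ j x) (Φ M j x) ≤ (∑ j, |r j - R M j|) * C := by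
    intro M j x hx
    have hrj := (hr j).1
    have hd : φ j x - Φ M j x = (1 - R M j / r j) • (φ j x - φ j 0) := by
      simp only [Φ]
      module
    have hnorm : ‖φ j x - φ j 0‖ = r j * ‖x‖ := by
      rw [← dist_eq_norm, hsim j, dist_zero_right]
    calc dist (φ j x) (Φ M j x) = |1 - R M j / r j| * |r j| * ‖x‖ := by
          rw [dist_eq_norm, hd, norm_smul, hnorm, Real.norm_eq_abs, abs_of_pos hrj, mul_assoc]
      _ = |r j - R M j| * ‖x‖ := by
          rw [← abs_mul, sub_mul, one_mul, div_mul_cancel₀ _ hrj.ne']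
      _ ≤ (∑ j, |r j - R M j|) * C := by
          gcongr
          · exact Finset.single_le_sum (f := fun j => |r j - R M j|)
              (fun _ _ => abs_nonneg _) (Finset.mem_univ j)
          · exact hC x hx
  choose A hA hAF using fun M => exists_isAttractor_hausdorffDist_le hF (K := K) (hr i).2 (hlip M)
    (mul_nonneg (Finset.sum_nonneg fun _ _ => abs_nonneg _) hC0.le) (hclose M)
  refine ⟨Φ, R, A, fun M j => ⟨hpos M j, (hle M j).trans_lt (hr j).2⟩, hΦ, hlat, hA, hlim,
    squeeze_zero (fun _ => hausdorffDist_nonneg) hAF ?_⟩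
  have hsum : Tendsto (fun M => ∑ j, |r j - R M j|) atTop (𝓝 0) := by
    simpa using tendsto_finsetSum Finset.univ fun j _ => ((hlim j).const_sub (r j)).abs
  simpa using (hsum.mul_const C).div_const (1 - (K : ℝ))
end

section
/- Let Ω ⊆ ℝ be a bounded open set with infinitely many connected components, and let L = (ℓ_j)_{j≥1} be the nonincreasing sequence of the lengths of these components (a fractal string). Suppose the Lebesgue measure of Ω equals sup Ω − inf Ω. Then D_L = 1 − liminf_{ε→0⁺} (log vol¹((∂Ω)_ε) / log ε); that is, the dimension of the fractal string L equals the upper Minkowski dimension of the boundary ∂Ω. -/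
open Filter Topology Metric MeasureTheory

/-- A component of a bounded open subset of `ℝ` is an open interval whose endpoints lie on the
boundary. -/
lemma exists_connectedComponentIn_eq_Ioo {Ω : Set ℝ} (hopen : IsOpen Ω)
    (hbdd : Bornology.IsBounded Ω) {x : ℝ} (hx : x ∈ Ω) :
    ∃ a b, a < b ∧ connectedComponentIn Ω x = Set.Ioo a b ∧
      a ∈ frontier Ω ∧ b ∈ frontier Ω := by
  set C := connectedComponentIn Ω x with hC
  have hCΩ : C ⊆ Ω := connectedComponentIn_subset Ω x
  have hxC : x ∈ C := mem_connectedComponentIn hx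
  have hb : Bornology.IsBounded C := hbdd.subset hCΩ
  have hCopen : IsOpen C := hopen.connectedComponentIn
  have hpre : IsPreconnected C := isPreconnected_connectedComponentIn
  have heq : C = Set.Ioo (sInf C) (sSup C) := by
    refine Set.Subset.antisymm ?_ (IsConnected.Ioo_csInf_csSup_subset ⟨⟨x, hxC⟩, hpre⟩ hb.bddBelow hb.bddAbove)
    have h := interior_mono (subset_Icc_csInf_csSup hb.bddBelow hb.bddAbove)
    rwa [hCopen.interior_eq, interior_Icc] at h
  obtain ⟨a, b, hab⟩ : ∃ a b, C = Set.Ioo a b := ⟨_, _, heq⟩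
  have hxab : x ∈ Set.Ioo a b := hab ▸ hxC
  have hlt : a < b := hxab.1.trans hxab.2
  have hcl : Set.Icc a b ⊆ closure Ω := by
    rw [← closure_Ioo hlt.ne, ← hab]
    exact closure_mono hCΩ
  refine ⟨a, b, hlt, hab, ?_, ?_⟩ <;> rw [hopen.frontier_eq]
  · refine ⟨hcl (Set.left_mem_Icc.2 hlt.le), fun ha => ?_⟩
    have hsub : Set.Ico a b ⊆ Ω := by
      rw [← Set.Ioo_union_left hlt, ← hab]
      exact Set.union_subset hCΩ (Set.singleton_subset_iff.2 ha)
    have h := isPreconnected_Ico.subset_connectedComponentIn (Set.Ioo_subset_Ico_self hxab) hsub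
    rw [← hC, hab] at h
    exact lt_irrefl a (h (Set.left_mem_Ico.2 hlt)).1
  · refine ⟨hcl (Set.right_mem_Icc.2 hlt.le), fun ha => ?_⟩
    have hsub : Set.Ioc a b ⊆ Ω := by
      rw [← Set.Ioo_union_right hlt, ← hab]
      exact Set.union_subset hCΩ (Set.singleton_subset_iff.2 ha)
    have h := isPreconnected_Ioc.subset_connectedComponentIn (Set.Ioo_subset_Ioc_self hxab) hsub
    rw [← hC, hab] at h
    exact lt_irrefl b (h (Set.right_mem_Ioc.2 hlt)).2

/-- The part of an `ε`-neighborhood of the boundary inside a component of length `b - a`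
has length `min (2 * ε) (b - a)`. -/
lemma volume_Ioo_inter_thickening_frontier {Ω : Set ℝ} (hopen : IsOpen Ω) {a b ε : ℝ}
    (hε : 0 < ε) (hsub : Set.Ioo a b ⊆ Ω) (ha : a ∈ frontier Ω) (hb : b ∈ frontier Ω) :
    volume (Set.Ioo a b ∩ thickening ε (frontier Ω)) = ENNReal.ofReal (min (2 * ε) (b - a)) := by
  have heq : Set.Ioo a b ∩ thickening ε (frontier Ω)
      = Set.Ioo a b \ Set.Icc (a + ε) (b - ε) := by
    ext x
    simp only [Set.mem_inter_iff, Set.mem_sdiff, mem_thickening_iff, Set.mem_Icc, not_and, not_le]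
    refine and_congr_right fun hx => ⟨?_, fun h => ?_⟩
    · rintro ⟨z, hz, hxz⟩ h1
      by_contra! h2
      rw [Real.dist_eq, abs_lt] at hxz
      rw [hopen.frontier_eq] at hz
      exact hz.2 (hsub ⟨by linarith, by linarith⟩)
    · by_cases h1 : a + ε ≤ x
      · refine ⟨b, hb, ?_⟩
        rw [Real.dist_eq, abs_lt]
        constructor <;> linarith [h h1, hx.2]
      · refine ⟨a, ha, ?_⟩
        rw [Real.dist_eq, abs_lt]
        constructor <;> linarith [hx.1]
  have hIcc : Set.Icc (a + ε) (b - ε) ⊆ Set.Ioo a b := fun x hx =>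
    ⟨by linarith [hx.1], by linarith [hx.2]⟩
  rw [heq, measure_sdiff hIcc measurableSet_Icc.nullMeasurableSet (by simp), Real.volume_Ioo,
    Real.volume_Icc]
  rcases le_total (2 * ε) (b - a) with h | h
  · rw [min_eq_left h, ← ENNReal.ofReal_sub _ (by linarith)]
    congr 1
    ring
  · rw [min_eq_right h, ENNReal.ofReal_of_nonpos (by linarith : b - ε - (a + ε) ≤ 0), tsub_zero]

lemma summable_min_of_summable {ℓ : ℕ → ℝ} (hpos : ∀ j, 0 < ℓ j) (hsum : Summable ℓ) {ε : ℝ}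
    (hε : 0 < ε) : Summable fun j => min (2 * ε) (ℓ j) :=
  hsum.of_nonneg_of_le (fun j => le_min (by positivity) (hpos j).le) fun _ => min_le_right _ _

/-- The inner `ε`-neighborhood of the boundary of a fractal string has volume
`∑ min (2ε) ℓ_j`; the outer part contributes at most `2ε`. -/
lemma volume_thickening_frontier_bounds {Ω : Set ℝ} (hopen : IsOpen Ω)
    (hbdd : Bornology.IsBounded Ω) {ℓ : ℕ → ℝ} (hpos : ∀ j, 0 < ℓ j)
    (e : ℕ ≃ {C : Set ℝ // ∃ x ∈ Ω, C = connectedComponentIn Ω x})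
    (hlen : ∀ j, ℓ j = (volume ((e j : Set ℝ))).toReal)
    (hvol : (volume Ω).toReal = sSup Ω - sInf Ω) :
    Summable ℓ ∧ ∀ ε > 0,
      ∑' j, min (2 * ε) (ℓ j) ≤ (volume (thickening ε (frontier Ω))).toReal ∧
      (volume (thickening ε (frontier Ω))).toReal ≤ 2 * ε + ∑' j, min (2 * ε) (ℓ j) := by
  have hcomp : ∀ j, ∃ a b, a < b ∧ (e j : Set ℝ) = Set.Ioo a b ∧
      a ∈ frontier Ω ∧ b ∈ frontier Ω := fun j => by
    obtain ⟨x, hx, h⟩ := (e j).2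
    rw [h]
    exact exists_connectedComponentIn_eq_Ioo hopen hbdd hx
  choose a b hab hC ha hb using hcomp
  have hsubΩ : ∀ j, (e j : Set ℝ) ⊆ Ω := fun j => by
    obtain ⟨x, hx, h⟩ := (e j).2
    rw [h]
    exact connectedComponentIn_subset Ω x
  have hunion : ⋃ j, (e j : Set ℝ) = Ω := by
    refine Set.Subset.antisymm (Set.iUnion_subset hsubΩ) fun x hx => ?_
    refine Set.mem_iUnion.2 ⟨e.symm ⟨connectedComponentIn Ω x, x, hx, rfl⟩, ?_⟩
    simpa using mem_connectedComponentIn hx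
  have hdisj : Pairwise (Function.onFun Disjoint fun j => (e j : Set ℝ)) := by
    intro i j hij
    refine Set.disjoint_left.2 fun y hyi hyj => hij (e.injective (Subtype.ext ?_))
    obtain ⟨x, hx, h⟩ := (e i).2
    obtain ⟨z, hz, h'⟩ := (e j).2
    replace hyi : y ∈ connectedComponentIn Ω x := h ▸ hyi
    replace hyj : y ∈ connectedComponentIn Ω z := h' ▸ hyj
    rw [h, h', connectedComponentIn_eq hyi, connectedComponentIn_eq hyj]
  have hmeas : ∀ j, MeasurableSet (e j : Set ℝ) := fun j => hC j ▸ measurableSet_Ioo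
  have hlen' : ∀ j, ℓ j = b j - a j := fun j => by
    rw [hlen, hC, Real.volume_Ioo, ENNReal.toReal_ofReal (by linarith [hab j])]
  have hΩfin : volume Ω ≠ ⊤ := hbdd.measure_lt_top.ne
  have hΩsum : volume Ω = ∑' j, volume (e j : Set ℝ) := by
    rw [← measure_iUnion hdisj hmeas, hunion]
  have hsum : Summable ℓ := by
    simp_rw [funext hlen]
    exact ENNReal.summable_toReal (hΩsum ▸ hΩfin)
  refine ⟨hsum, fun ε hε => ?_⟩
  have hIcc : Ω ⊆ Set.Icc (sInf Ω) (sSup Ω) :=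
    subset_Icc_csInf_csSup hbdd.bddBelow hbdd.bddAbove
  have hnull : volume (Set.Icc (sInf Ω) (sSup Ω) \ Ω) = 0 := by
    rw [measure_sdiff hIcc hopen.measurableSet.nullMeasurableSet hΩfin, Real.volume_Icc, ← hvol,
      ENNReal.ofReal_toReal hΩfin, tsub_self]
  set T := thickening ε (frontier Ω) with hT
  have hfr : frontier Ω ⊆ Set.Icc (sInf Ω) (sSup Ω) :=
    frontier_subset_closure.trans (closure_minimal hIcc isClosed_Icc)
  have hTsub : T ⊆ Set.Ioo (sInf Ω - ε) (sSup Ω + ε) := by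
    intro x hx
    obtain ⟨z, hz, hxz⟩ := mem_thickening_iff.1 hx
    rw [Real.dist_eq, abs_lt] at hxz
    exact ⟨by linarith [(hfr hz).1], by linarith [(hfr hz).2]⟩
  have hTfin : volume T ≠ ⊤ := ((measure_mono hTsub).trans_lt measure_Ioo_lt_top).ne
  have hinner : volume (Ω ∩ T) = ENNReal.ofReal (∑' j, min (2 * ε) (ℓ j)) := by
    rw [ENNReal.ofReal_tsum_of_nonneg (fun j => le_min (by positivity) (hpos j).le)
      (summable_min_of_summable hpos hsum hε)]
    rw [← hunion, Set.iUnion_inter, measure_iUnion]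
    · refine tsum_congr fun j => ?_
      rw [hlen', hC]
      exact volume_Ioo_inter_thickening_frontier hopen hε (hC j ▸ hsubΩ j) (ha j) (hb j)
    · exact fun i j hij => (hdisj hij).mono Set.inter_subset_left Set.inter_subset_left
    · exact fun j => (hmeas j).inter isOpen_thickening.measurableSet
  have hnn : 0 ≤ ∑' j, min (2 * ε) (ℓ j) :=
    tsum_nonneg fun j => le_min (by positivity) (hpos j).le
  constructor
  · rw [← ENNReal.ofReal_le_iff_le_toReal hTfin, ← hinner]
    exact measure_mono Set.inter_subset_right
  · refine ENNReal.toReal_le_of_le_ofReal (by positivity) ?_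
    have hcover : T ⊆ (Set.Ioc (sInf Ω - ε) (sInf Ω) ∪ Set.Ico (sSup Ω) (sSup Ω + ε)) ∪
        ((Set.Icc (sInf Ω) (sSup Ω) \ Ω) ∪ (Ω ∩ T)) := by
      intro x hx
      have hx' := hTsub hx
      by_cases hxΩ : x ∈ Ω
      · exact Or.inr (Or.inr ⟨hxΩ, hx⟩)
      by_cases h1 : x ≤ sInf Ω
      · exact Or.inl (Or.inl ⟨hx'.1, h1⟩)
      by_cases h2 : sSup Ω ≤ x
      · exact Or.inl (Or.inr ⟨h2, hx'.2⟩)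
      · exact Or.inr (Or.inl ⟨⟨(not_le.1 h1).le, (not_le.1 h2).le⟩, hxΩ⟩)
    calc volume T ≤ _ := measure_mono hcover
      _ ≤ (volume (Set.Ioc (sInf Ω - ε) (sInf Ω)) + volume (Set.Ico (sSup Ω) (sSup Ω + ε))) +
        (volume (Set.Icc (sInf Ω) (sSup Ω) \ Ω) + volume (Ω ∩ T)) :=
          (measure_union_le _ _).trans
            (add_le_add (measure_union_le _ _) (measure_union_le _ _))
      _ = ENNReal.ofReal (2 * ε + ∑' j, min (2 * ε) (ℓ j)) := by
        rw [hnull, hinner, Real.volume_Ioc, Real.volume_Ico, zero_add,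
          ← ENNReal.ofReal_add (by linarith) (by linarith), ← ENNReal.ofReal_add (by linarith) hnn]
        congr 1
        ring

/-- Interpolation: `∑ min (2ε) ℓ_j ≤ (2ε)^(1-α) ∑ ℓ_j^α` for `α ≤ 1`. -/
lemma tsum_min_le_rpow_mul {ℓ : ℕ → ℝ} (hpos : ∀ j, 0 < ℓ j) (hsum : Summable ℓ) {α : ℝ}
    (hα0 : 0 ≤ α) (hα1 : α ≤ 1) (hα : Summable fun j => ℓ j ^ α) {ε : ℝ} (hε : 0 < ε) :
    ∑' j, min (2 * ε) (ℓ j) ≤ (2 * ε) ^ (1 - α) * ∑' j, ℓ j ^ α := by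
  rw [← tsum_mul_left]
  refine (summable_min_of_summable hpos hsum hε).tsum_le_tsum (fun j => ?_) (hα.mul_left _)
  have hm : 0 < min (2 * ε) (ℓ j) := lt_min (by positivity) (hpos j)
  calc min (2 * ε) (ℓ j) = min (2 * ε) (ℓ j) ^ (1 - α) * min (2 * ε) (ℓ j) ^ α := by
        rw [← Real.rpow_add hm, sub_add_cancel, Real.rpow_one]
    _ ≤ (2 * ε) ^ (1 - α) * ℓ j ^ α :=
        mul_le_mul (Real.rpow_le_rpow hm.le (min_le_left _ _) (by linarith))
          (Real.rpow_le_rpow hm.le (min_le_right _ _) hα0) (by positivity) (by positivity)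

/-- For a nonincreasing sequence, `∑ min ℓ_n ℓ_j ≥ (n + 1) ℓ_n`. -/
lemma succ_mul_le_tsum_min {ℓ : ℕ → ℝ} (hpos : ∀ j, 0 < ℓ j) (hanti : Antitone ℓ)
    (hsum : Summable ℓ) (n : ℕ) {ε : ℝ} (hε : 0 < ε) (hle : 2 * ε ≤ ℓ n) :
    (n + 1 : ℝ) * (2 * ε) ≤ ∑' j, min (2 * ε) (ℓ j) := by
  have h := (summable_min_of_summable hpos hsum hε).sum_le_tsum (Finset.range (n + 1))
    fun j _ => le_min (by positivity) (hpos j).le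
  refine le_trans (le_of_eq ?_) h
  rw [Finset.sum_congr rfl fun j hj => min_eq_left
    (hle.trans (hanti (Nat.lt_succ_iff.1 (Finset.mem_range.1 hj))))]
  simp

/-- A power bound on `∑ min (2ε) ℓ_j` forces summability of the powers `ℓ_j ^ α`. -/
lemma summable_rpow_of_eventually_tsum_min_le {ℓ : ℕ → ℝ} (hpos : ∀ j, 0 < ℓ j)
    (hanti : Antitone ℓ) (hlim : Tendsto ℓ atTop (𝓝 0)) (hsum : Summable ℓ) {α β : ℝ}
    (hβ : β < 1) (hαβ : 1 - β < α)
    (hV : ∀ᶠ ε in 𝓝[>] (0 : ℝ), ∑' j, min (2 * ε) (ℓ j) ≤ ε ^ β) :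
    Summable fun j => ℓ j ^ α := by
  have hβ' : 0 < 1 - β := by linarith
  have hp : 1 < α / (1 - β) := (one_lt_div hβ').2 hαβ
  have hhalf : Tendsto (fun j => ℓ j / 2) atTop (𝓝[>] (0 : ℝ)) :=
    tendsto_nhdsWithin_iff.2 ⟨by simpa using hlim.div_const 2,
      Eventually.of_forall fun j => half_pos (hpos j)⟩
  have hps : Summable fun j : ℕ => (((j + 1 : ℕ) : ℝ) ^ (α / (1 - β)))⁻¹ :=
    (summable_nat_add_iff 1).2 (Real.summable_nat_rpow_inv.2 hp)
  refine (hps.mul_left ((2 : ℝ) ^ α)).of_norm_bounded_eventually_nat ?_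
  filter_upwards [hhalf.eventually hV] with n hn
  set t := ℓ n / 2 with ht
  have ht0 : 0 < t := half_pos (hpos n)
  have h2t : ℓ n = 2 * t := by rw [ht]; ring
  have h1 := (succ_mul_le_tsum_min hpos hanti hsum n ht0 h2t.ge).trans hn
  have h2 : ((n + 1 : ℕ) : ℝ) ≤ t ^ (-(1 - β)) := by
    have h3 : t ^ β = t ^ (-(1 - β)) * t := by
      rw [← Real.rpow_add_one ht0.ne']
      congr 1
      ring
    rw [h3] at h1
    push_cast
    have : (n + 1 : ℝ) * t ≤ t ^ (-(1 - β)) * t := by nlinarith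
    exact le_of_mul_le_mul_right this ht0
  have hn0 : (0 : ℝ) < ((n + 1 : ℕ) : ℝ) := by positivity
  have h4 := Real.rpow_le_rpow hn0.le h2 (by positivity : 0 ≤ α / (1 - β))
  rw [← Real.rpow_mul ht0.le, show -(1 - β) * (α / (1 - β)) = -α by field_simp,
    Real.rpow_neg ht0.le] at h4
  rw [Real.norm_of_nonneg (Real.rpow_nonneg (hpos n).le _), h2t,
    Real.mul_rpow zero_le_two ht0.le]
  gcongr
  exact (le_inv_comm₀ (by positivity) (by positivity)).1 h4

/-- The dimension of a summable fractal string is read off from any function comparable to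
`∑ min (2ε) ℓ_j`. -/
lemma sInf_summable_rpow_eq_one_sub_liminf {ℓ : ℕ → ℝ} (hpos : ∀ j, 0 < ℓ j)
    (hanti : Antitone ℓ) (hlim : Tendsto ℓ atTop (𝓝 0)) (hsum : Summable ℓ) {V : ℝ → ℝ}
    (hV : ∀ ε > 0, ∑' j, min (2 * ε) (ℓ j) ≤ V ε ∧ V ε ≤ 2 * ε + ∑' j, min (2 * ε) (ℓ j)) :
    sInf {α : ℝ | Summable fun j => ℓ j ^ α} =
      1 - Filter.liminf (fun ε : ℝ => Real.log (V ε) / Real.log ε) (𝓝[>] (0 : ℝ)) := by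
  set f : ℝ → ℝ := fun ε => Real.log (V ε) / Real.log ε with hf
  have hsmall : ∀ δ > 0, ∀ᶠ ε in 𝓝[>] (0 : ℝ), 0 < ε ∧ ε < δ := fun δ hδ =>
    Ioo_mem_nhdsGT hδ
  have hlower : ∀ᶠ ε in 𝓝[>] (0 : ℝ), 2 * ε ≤ V ε := by
    filter_upwards [hsmall (ℓ 0 / 2) (half_pos (hpos 0))] with ε ⟨h0, h1⟩
    have h := succ_mul_le_tsum_min hpos hanti hsum 0 h0 (by linarith)
    push_cast at h
    linarith [(hV ε h0).1]
  have hf1 : ∀ᶠ ε in 𝓝[>] (0 : ℝ), f ε ≤ 1 := by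
    filter_upwards [hlower, hsmall 1 one_pos] with ε h ⟨h0, h1⟩
    rw [hf, div_le_one_of_neg (Real.log_neg h0 h1)]
    exact Real.log_le_log h0 (by linarith)
  have hpos_of_summable : ∀ α : ℝ, (Summable fun j => ℓ j ^ α) → 0 < α := by
    intro α hα
    by_contra! h
    have h1 : ∀ᶠ j in atTop, ℓ j ^ α < 1 := hα.tendsto_atTop_zero.eventually_lt_const one_pos
    obtain ⟨j, hj, hj'⟩ := (h1.and (hlim.eventually_lt_const one_pos)).exists
    exact absurd (Real.one_le_rpow_of_pos_of_le_one_of_nonpos (hpos j) hj'.le h) (not_le.2 hj)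
  have hlow : ∀ α : ℝ, α ≤ 1 → (Summable fun j => ℓ j ^ α) → ∀ c < 1 - α,
      ∀ᶠ ε in 𝓝[>] (0 : ℝ), c ≤ f ε := by
    intro α hα1 hα c hc
    have hα0 := hpos_of_summable α hα
    set K := ∑' j, ℓ j ^ α with hK
    have hK0 : 0 ≤ K := tsum_nonneg fun j => Real.rpow_nonneg (hpos j).le _
    have hlog : Tendsto (fun ε => Real.log (2 + 2 ^ (1 - α) * K) / Real.log ε)
        (𝓝[>] (0 : ℝ)) (𝓝 0) := Real.tendsto_log_nhdsGT_zero.const_div_atBot _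
    filter_upwards [hlower, hsmall 1 one_pos,
      hlog.eventually (lt_mem_nhds (sub_neg.2 hc))] with ε h ⟨h0, h1⟩ h2
    have hneg := Real.log_neg h0 h1
    have hε : 0 < ε ^ (1 - α) := Real.rpow_pos_of_pos h0 _
    have h3 : V ε ≤ (2 + 2 ^ (1 - α) * K) * ε ^ (1 - α) := by
      have h4 := tsum_min_le_rpow_mul hpos hsum hα0.le hα1 hα h0
      rw [Real.mul_rpow zero_le_two h0.le] at h4
      have h5 : ε ≤ ε ^ (1 - α) := by
        simpa using Real.rpow_le_rpow_of_exponent_ge h0 h1.le (by linarith : 1 - α ≤ 1)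
      nlinarith [(hV ε h0).2]
    have h6 := Real.log_le_log (by linarith) h3
    rw [Real.log_mul (by positivity) hε.ne', Real.log_rpow h0] at h6
    rw [lt_div_iff_of_neg hneg] at h2
    rw [hf, le_div_iff_of_neg hneg]
    linarith
  have hone : Summable fun j => ℓ j ^ (1 : ℝ) := by simpa using hsum
  have hbelow : (𝓝[>] (0 : ℝ)).IsBoundedUnder (· ≥ ·) f :=
    ⟨-1, hlow 1 le_rfl hone (-1) (by norm_num)⟩
  have habove : (𝓝[>] (0 : ℝ)).IsBoundedUnder (· ≤ ·) f := ⟨1, hf1⟩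
  set L := liminf f (𝓝[>] (0 : ℝ)) with hL
  have hL1 : L ≤ 1 := (liminf_le_limsup habove hbelow).trans
    (limsup_le_of_le hbelow.isCoboundedUnder_le hf1)
  have hL_ge : ∀ α : ℝ, α ≤ 1 → (Summable fun j => ℓ j ^ α) → 1 - α ≤ L := fun α hα1 hα =>
    le_of_forall_lt fun c hc => by
      obtain ⟨d, hcd, hd⟩ := exists_between hc
      exact hcd.trans_le (le_liminf_of_le habove.isCoboundedUnder_ge (hlow α hα1 hα d hd))
  apply le_antisymm
  · refine le_of_forall_gt fun α hα => ?_
    obtain ⟨γ, hγ1, hγ2⟩ := exists_between hα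
    refine lt_of_le_of_lt (csInf_le ⟨0, fun x hx => (hpos_of_summable x hx).le⟩ ?_) hγ2
    obtain ⟨β, hβ1, hβ2⟩ := exists_between (show 1 - γ < L by linarith)
    refine summable_rpow_of_eventually_tsum_min_le hpos hanti hlim hsum (β := β)
      (by linarith) (by linarith) ?_
    filter_upwards [eventually_lt_of_lt_liminf hβ2 hbelow, hlower, hsmall 1 one_pos]
      with ε h1 h2 ⟨h3, h4⟩
    refine (hV ε h3).1.trans ?_
    rw [hf, lt_div_iff_of_neg (Real.log_neg h3 h4), ← Real.log_rpow h3] at h1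
    exact ((Real.log_lt_log_iff (by linarith) (Real.rpow_pos_of_pos h3 _)).1 h1).le
  · refine le_csInf ⟨1, hone⟩ fun α hα => ?_
    rcases le_total α 1 with h | h
    · linarith [hL_ge α h hα]
    · linarith [hL_ge 1 le_rfl hone]

/-- For a bounded open set `Ω ⊆ ℝ` whose (infinitely many) connected components have lengths
given by the nonincreasing fractal string `ℓ`, and whose total length fills the interval
`[inf Ω, sup Ω]`, the dimension of the fractal string,
`D_L = inf {α : ∑ ℓ_j^α < ∞}`, equals the upper Minkowski dimension of the boundary `∂Ω`,
`1 - liminf_{ε→0⁺} log vol¹((∂Ω)_ε) / log ε`. -/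
theorem stmt3 (Ω : Set ℝ) (hopen : IsOpen Ω) (hbdd : Bornology.IsBounded Ω)
    (ℓ : ℕ → ℝ) (hpos : ∀ j, 0 < ℓ j) (hanti : Antitone ℓ)
    (hlim : Tendsto ℓ atTop (𝓝 0))
    (e : ℕ ≃ {C : Set ℝ // ∃ x ∈ Ω, C = connectedComponentIn Ω x})
    (hlen : ∀ j, ℓ j = (volume ((e j : Set ℝ))).toReal)
    (hvol : (volume Ω).toReal = sSup Ω - sInf Ω) :
    sInf {α : ℝ | Summable fun j => ℓ j ^ α} =
      1 - Filter.liminf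
        (fun ε : ℝ => Real.log ((volume (thickening ε (frontier Ω))).toReal) / Real.log ε)
        (𝓝[>] (0 : ℝ)) := by
  obtain ⟨hsum, hV⟩ := volume_thickening_frontier_bounds hopen hbdd hpos e hlen hvol
  exact sInf_summable_rpow_eq_one_sub_liminf hpos hanti hlim hsum hV
end

section
/- Let L = (ℓ_j)_{j≥1} be a fractal string with geometric counting function N_L. For every s ∈ ℂ with Re(s) > D_L, the integral ∫_0^∞ N_L(x) x^{−s−1} dx converges absolutely and ζ_L(s) = s·∫_0^∞ N_L(x) x^{−s−1} dx. Moreover, for every real t < D_L the integral ∫_0^∞ N_L(x) x^{−t−1} dx diverges. -/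
open Filter Topology MeasureTheory

theorem finite_setOf_inv_le {ℓ : ℕ → ℝ} (hpos : ∀ j, 0 < ℓ j)
    (hlim : Tendsto ℓ atTop (𝓝 0)) (x : ℝ) : {j : ℕ | (ℓ j)⁻¹ ≤ x}.Finite := by
  have h : Tendsto (fun j => (ℓ j)⁻¹) atTop atTop :=
    (tendsto_nhdsWithin_iff.2 ⟨hlim, Eventually.of_forall hpos⟩).inv_tendsto_nhdsGT_zero
  have h' := h.eventually_gt_atTop x
  rw [← Nat.cofinite_eq_atTop, eventually_cofinite] at h'
  simpa only [not_lt] using h'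

theorem measurable_card_setOf_inv_le {ℓ : ℕ → ℝ} (hpos : ∀ j, 0 < ℓ j)
    (hlim : Tendsto ℓ atTop (𝓝 0)) :
    Measurable fun x : ℝ => Nat.card {j : ℕ | (ℓ j)⁻¹ ≤ x} :=
  Monotone.measurable fun _ y hxy =>
    Nat.card_mono (finite_setOf_inv_le hpos hlim y) fun _ hj => le_trans hj hxy

theorem tsum_indicator_Ici_inv {R : Type*} [NormedRing R] (ℓ : ℕ → ℝ) (g : ℝ → R) (x : ℝ) :
    ∑' j, (Set.Ici (ℓ j)⁻¹).indicator g x = (Nat.card {j : ℕ | (ℓ j)⁻¹ ≤ x} : R) * g x := by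
  have h : (fun j => (Set.Ici (ℓ j)⁻¹).indicator g x) =
      {j : ℕ | (ℓ j)⁻¹ ≤ x}.indicator fun _ => g x := by
    ext j
    simp [Set.indicator_apply]
  rw [h, ← tsum_subtype, tsum_const, nsmul_eq_mul]

theorem summable_indicator_Ici_inv {R : Type*} [NormedRing R] {ℓ : ℕ → ℝ}
    (hpos : ∀ j, 0 < ℓ j) (hlim : Tendsto ℓ atTop (𝓝 0)) (g : ℝ → R) (x : ℝ) :
    Summable fun j => (Set.Ici (ℓ j)⁻¹).indicator g x := by
  refine summable_of_hasFiniteSupport ((finite_setOf_inv_le hpos hlim x).subset fun j hj => ?_)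
  by_contra h
  exact hj (Set.indicator_of_notMem (s := Set.Ici (ℓ j)⁻¹) h g)

theorem setIntegral_indicator_Ici {E : Type*} [NormedAddCommGroup E] [NormedSpace ℝ E]
    (g : ℝ → E) {a : ℝ} (ha : 0 < a) :
    ∫ x in Set.Ioi (0 : ℝ), (Set.Ici a).indicator g x = ∫ x in Set.Ioi a, g x := by
  rw [setIntegral_indicator measurableSet_Ici,
    Set.inter_eq_right.2 (Set.Ici_subset_Ioi.2 ha), integral_Ici_eq_integral_Ioi]

theorem integrableOn_indicator_Ici {E : Type*} [NormedAddCommGroup E]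
    {g : ℝ → E} {a : ℝ} (hg : IntegrableOn g (Set.Ioi a)) :
    IntegrableOn ((Set.Ici a).indicator g) (Set.Ioi (0 : ℝ)) :=
  (((integrableOn_Ici_iff_integrableOn_Ioi).2 hg).integrable_indicator
    measurableSet_Ici).integrableOn

theorem integral_indicator_Ici_inv_rpow {a t : ℝ} (ha : 0 < a) (ht : 0 < t) :
    ∫ x in Set.Ioi (0 : ℝ), (Set.Ici a⁻¹).indicator (fun x => x ^ (-t - 1)) x = a ^ t / t := by
  rw [setIntegral_indicator_Ici _ (inv_pos.2 ha),
    integral_Ioi_rpow_of_lt (by linarith) (inv_pos.2 ha), sub_add_cancel,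
    Real.inv_rpow ha.le, Real.rpow_neg ha.le, inv_inv, neg_div_neg_eq]

theorem integral_indicator_Ici_inv_cpow {a : ℝ} {s : ℂ} (ha : 0 < a) (hs : 0 < s.re) :
    ∫ x in Set.Ioi (0 : ℝ), (Set.Ici a⁻¹).indicator (fun x : ℝ => (x : ℂ) ^ (-s - 1)) x =
      (a : ℂ) ^ s / s := by
  have h : ((a⁻¹ : ℝ) : ℂ) ^ (-s) = (a : ℂ) ^ s := by
    rw [Complex.ofReal_inv, Complex.inv_cpow _ _ (by
      rw [Complex.arg_ofReal_of_nonneg ha.le]; exact Real.pi_pos.ne), Complex.cpow_neg, inv_inv]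
  rw [setIntegral_indicator_Ici _ (inv_pos.2 ha),
    integral_Ioi_cpow_of_lt (by simp; linarith) (inv_pos.2 ha), sub_add_cancel, h,
    neg_div_neg_eq]

theorem pos_of_summable_rpow {ℓ : ℕ → ℝ} (hpos : ∀ j, 0 < ℓ j)
    (hlim : Tendsto ℓ atTop (𝓝 0)) {α : ℝ} (h : Summable fun j => ℓ j ^ α) : 0 < α := by
  by_contra! hα
  have h1 : ∀ᶠ j in atTop, 1 ≤ ℓ j ^ α := by
    filter_upwards [hlim.eventually_le_const one_pos] with j hj
    exact Real.one_le_rpow_of_pos_of_le_one_of_nonpos (hpos j) hj hα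
  exact absurd (ge_of_tendsto h.tendsto_atTop_zero h1) (by norm_num)

theorem summable_rpow_of_le {ℓ : ℕ → ℝ} (hpos : ∀ j, 0 < ℓ j)
    (hlim : Tendsto ℓ atTop (𝓝 0)) {α β : ℝ} (hαβ : α ≤ β)
    (h : Summable fun j => ℓ j ^ α) : Summable fun j => ℓ j ^ β := by
  refine h.of_norm_bounded_eventually_nat ?_
  filter_upwards [hlim.eventually_le_const one_pos] with j hj
  rw [Real.norm_of_nonneg (Real.rpow_nonneg (hpos j).le _)]
  exact Real.rpow_le_rpow_of_exponent_ge (hpos j) hj hαβ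

theorem integrableOn_card_mul_rpow {ℓ : ℕ → ℝ} (hpos : ∀ j, 0 < ℓ j) {t : ℝ} (ht : 0 < t)
    (h : Summable fun j => ℓ j ^ t) :
    IntegrableOn (fun x : ℝ => (Nat.card {j : ℕ | (ℓ j)⁻¹ ≤ x} : ℝ) * x ^ (-t - 1))
      (Set.Ioi (0 : ℝ)) := by
  have hF : ∀ j, IntegrableOn ((Set.Ici (ℓ j)⁻¹).indicator fun x : ℝ => x ^ (-t - 1))
      (Set.Ioi (0 : ℝ)) := fun j => integrableOn_indicator_Ici
    (integrableOn_Ioi_rpow_of_lt (by linarith) (inv_pos.2 (hpos j)))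
  have hnorm : ∀ j, ∫ x in Set.Ioi (0 : ℝ),
      ‖(Set.Ici (ℓ j)⁻¹).indicator (fun x : ℝ => x ^ (-t - 1)) x‖ = ℓ j ^ t / t := fun j => by
    rw [← integral_indicator_Ici_inv_rpow (hpos j) ht]
    refine setIntegral_congr_fun measurableSet_Ioi fun x hx => Real.norm_of_nonneg ?_
    exact Set.indicator_apply_nonneg fun _ => Real.rpow_nonneg (le_of_lt hx) _
  have hsum := hasSum_integral_of_summable_integral_norm hF
    (by simpa only [hnorm] using h.div_const t)
  simp only [integral_indicator_Ici_inv_rpow (hpos _) ht, tsum_indicator_Ici_inv] at hsum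
  refine not_imp_comm.1 integral_undef (ne_of_gt ?_)
  rw [← hsum.tsum_eq]
  exact (h.div_const t).tsum_pos (fun j => (div_pos (Real.rpow_pos_of_pos (hpos j) t) ht).le) 0
    (div_pos (Real.rpow_pos_of_pos (hpos 0) t) ht)

theorem integrableOn_card_mul_cpow {ℓ : ℕ → ℝ} (hpos : ∀ j, 0 < ℓ j)
    (hlim : Tendsto ℓ atTop (𝓝 0)) {s : ℂ} (hs : 0 < s.re)
    (h : Summable fun j => ℓ j ^ s.re) :
    IntegrableOn (fun x : ℝ => (Nat.card {j : ℕ | (ℓ j)⁻¹ ≤ x} : ℂ) * (x : ℂ) ^ (-s - 1))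
      (Set.Ioi (0 : ℝ)) := by
  refine (integrableOn_card_mul_rpow hpos hs h).mono' ?_ ?_
  · have hcard := (measurable_from_top (f := fun n : ℕ => (n : ℂ))).comp
      (measurable_card_setOf_inv_le hpos hlim)
    exact (hcard.mul (Complex.measurable_ofReal.pow_const _)).aestronglyMeasurable
  · filter_upwards [ae_restrict_mem measurableSet_Ioi] with x hx
    rw [norm_mul, Complex.norm_natCast, Complex.norm_cpow_eq_rpow_re_of_pos hx]
    simp

theorem tsum_cpow_eq_mul_integral {ℓ : ℕ → ℝ} (hpos : ∀ j, 0 < ℓ j) {s : ℂ} (hs : 0 < s.re)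
    (h : Summable fun j => ℓ j ^ s.re) :
    ∑' j, (ℓ j : ℂ) ^ s = s * ∫ x in Set.Ioi (0 : ℝ),
      (Nat.card {j : ℕ | (ℓ j)⁻¹ ≤ x} : ℂ) * (x : ℂ) ^ (-s - 1) := by
  have hs0 : s ≠ 0 := fun h0 => by simp [h0] at hs
  have hF : ∀ j, IntegrableOn ((Set.Ici (ℓ j)⁻¹).indicator fun x : ℝ => (x : ℂ) ^ (-s - 1))
      (Set.Ioi (0 : ℝ)) := fun j => integrableOn_indicator_Ici
    (integrableOn_Ioi_cpow_of_lt (by simp; linarith) (inv_pos.2 (hpos j)))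
  have hnorm : ∀ j, ∫ x in Set.Ioi (0 : ℝ),
      ‖(Set.Ici (ℓ j)⁻¹).indicator (fun x : ℝ => (x : ℂ) ^ (-s - 1)) x‖ =
        ℓ j ^ s.re / s.re := fun j => by
    rw [← integral_indicator_Ici_inv_rpow (hpos j) hs]
    refine setIntegral_congr_fun measurableSet_Ioi fun x hx => ?_
    simp only [norm_indicator_eq_indicator_norm]
    simp [Set.indicator_apply, Complex.norm_cpow_eq_rpow_re_of_pos hx]
  have hsum := hasSum_integral_of_summable_integral_norm hF
    (by simpa only [hnorm] using h.div_const s.re)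
  simp only [integral_indicator_Ici_inv_cpow (hpos _) hs, tsum_indicator_Ici_inv] at hsum
  rw [← hsum.tsum_eq, tsum_div_const, mul_div_cancel₀ _ hs0]

theorem pos_of_integrableOn_card_mul_rpow {ℓ : ℕ → ℝ} (hpos : ∀ j, 0 < ℓ j)
    (hlim : Tendsto ℓ atTop (𝓝 0)) {t : ℝ}
    (h : IntegrableOn (fun x : ℝ => (Nat.card {j : ℕ | (ℓ j)⁻¹ ≤ x} : ℝ) * x ^ (-t - 1))
      (Set.Ioi (0 : ℝ))) : 0 < t := by
  have h0 : 0 < (ℓ 0)⁻¹ := inv_pos.2 (hpos 0)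
  have hint : IntegrableOn (fun x : ℝ => x ^ (-t - 1)) (Set.Ioi (ℓ 0)⁻¹) := by
    refine (h.mono_set (Set.Ioi_subset_Ioi h0.le)).mono'
      (measurable_id.pow_const _).aestronglyMeasurable ?_
    filter_upwards [ae_restrict_mem measurableSet_Ioi] with x hx
    have hx0 : 0 ≤ x ^ (-t - 1) := Real.rpow_nonneg (h0.trans hx).le _
    rw [Real.norm_of_nonneg hx0]
    refine le_mul_of_one_le_left hx0 ?_
    have := (finite_setOf_inv_le hpos hlim x).to_subtype
    have : Nonempty {j : ℕ | (ℓ j)⁻¹ ≤ x} := ⟨0, (Set.mem_Ioi.1 hx).le⟩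
    exact_mod_cast Nat.card_pos (α := {j : ℕ | (ℓ j)⁻¹ ≤ x})
  linarith [(integrableOn_Ioi_rpow_iff h0).1 hint]

theorem summable_rpow_of_integrableOn_card_mul_rpow {ℓ : ℕ → ℝ} (hpos : ∀ j, 0 < ℓ j)
    (hlim : Tendsto ℓ atTop (𝓝 0)) {t : ℝ}
    (h : IntegrableOn (fun x : ℝ => (Nat.card {j : ℕ | (ℓ j)⁻¹ ≤ x} : ℝ) * x ^ (-t - 1))
      (Set.Ioi (0 : ℝ))) : Summable fun j => ℓ j ^ t := by
  have ht := pos_of_integrableOn_card_mul_rpow hpos hlim h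
  have hF : ∀ j, IntegrableOn ((Set.Ici (ℓ j)⁻¹).indicator fun x : ℝ => x ^ (-t - 1))
      (Set.Ioi (0 : ℝ)) := fun j => integrableOn_indicator_Ici
    (integrableOn_Ioi_rpow_of_lt (by linarith) (inv_pos.2 (hpos j)))
  have hdiv : Summable fun j => ℓ j ^ t / t := by
    refine summable_of_sum_le
      (c := ∫ x in Set.Ioi (0 : ℝ), (Nat.card {j : ℕ | (ℓ j)⁻¹ ≤ x} : ℝ) * x ^ (-t - 1))
      (fun j => (div_pos (Real.rpow_pos_of_pos (hpos j) t) ht).le)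
      fun S => ?_
    simp only [← integral_indicator_Ici_inv_rpow (hpos _) ht]
    rw [← integral_finsetSum S fun j _ => hF j]
    refine setIntegral_mono_on (integrable_finsetSum S fun j _ => hF j) h measurableSet_Ioi
      fun x hx => ?_
    rw [← tsum_indicator_Ici_inv ℓ (fun x : ℝ => x ^ (-t - 1)) x]
    exact (summable_indicator_Ici_inv hpos hlim _ x).sum_le_tsum S fun j _ =>
      Set.indicator_apply_nonneg fun _ => Real.rpow_nonneg (le_of_lt hx) _
  simpa only [div_mul_cancel₀ _ ht.ne'] using hdiv.mul_right t

/-- For a fractal string `ℓ` with dimension `D_L = inf {α : ∑ ℓ_j^α < ∞}` (as an extended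
real, so that `D_L = +∞` when the set is empty) and geometric counting function
`N_L(x) = #{j : ℓ_j⁻¹ ≤ x}`:
for `Re s > D_L` the integral `∫_0^∞ N_L(x) x^{-s-1} dx` converges absolutely and
`ζ_L(s) = ∑ ℓ_j^s = s ∫_0^∞ N_L(x) x^{-s-1} dx`; while for real `t < D_L` the integral
diverges. -/
theorem stmt4 (ℓ : ℕ → ℝ) (hpos : ∀ j, 0 < ℓ j) (hanti : Antitone ℓ)
    (hlim : Tendsto ℓ atTop (𝓝 0)) :
    (∀ s : ℂ,
      sInf ((fun α : ℝ => (α : EReal)) '' {α : ℝ | Summable fun j => ℓ j ^ α}) < (s.re : EReal) →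
      MeasureTheory.IntegrableOn
        (fun x : ℝ => (Nat.card {j : ℕ | (ℓ j)⁻¹ ≤ x} : ℂ) * (x : ℂ) ^ (-s - 1))
        (Set.Ioi (0 : ℝ)) ∧
      ∑' j, ((ℓ j : ℂ)) ^ s =
        s * (∫ x in Set.Ioi (0 : ℝ), (Nat.card {j : ℕ | (ℓ j)⁻¹ ≤ x} : ℂ) * (x : ℂ) ^ (-s - 1))) ∧
    (∀ t : ℝ,
      (t : EReal) < sInf ((fun α : ℝ => (α : EReal)) '' {α : ℝ | Summable fun j => ℓ j ^ α}) →
      ¬ MeasureTheory.IntegrableOn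
        (fun x : ℝ => (Nat.card {j : ℕ | (ℓ j)⁻¹ ≤ x} : ℝ) * x ^ (-t - 1))
        (Set.Ioi (0 : ℝ))) := by
  refine ⟨fun s hs => ?_, fun t ht h => ?_⟩
  · obtain ⟨_, ⟨α, hα, rfl⟩, hαs⟩ := sInf_lt_iff.1 hs
    have hαs' : α < s.re := EReal.coe_lt_coe_iff.1 hαs
    have hs0 : 0 < s.re := (pos_of_summable_rpow hpos hlim hα).trans hαs'
    have hsum := summable_rpow_of_le hpos hlim hαs'.le hα
    exact ⟨integrableOn_card_mul_cpow hpos hlim hs0 hsum,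
      tsum_cpow_eq_mul_integral hpos hs0 hsum⟩
  · exact ht.not_ge (sInf_le
      ⟨t, summable_rpow_of_integrableOn_card_mul_rpow hpos hlim h, rfl⟩)
end

section
/- Let Φ = {φ_j}_{j=1}^N be a self-similar system on ℝ satisfying the open set condition, with attractor F and scaling vector r = (r_j) such that ∑_{j=1}^N r_j < 1. Set I := [inf F, sup F], L := sup F − inf F > 0, and Ω := I ∖ F. Assume the intervals φ_1(I),…,φ_N(I) have pairwise disjoint interiors. Let g_1 L,…,g_K L be the lengths of the connected components of I ∖ ⋃_{j=1}^N φ_j(I) that have positive length (so that ∑_{k=1}^K g_k + ∑_{j=1}^N r_j = 1). Then for every s ∈ ℂ with Re(s) > D_r, the series ∑_J (length(J))^s taken over the connected components J of Ω converges absolutely and equals L^s·(∑_{k=1}^K g_k^s)/(1 − ∑_{j=1}^N r_j^s). -/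
open Filter Topology Metric MeasureTheory

/-- `φ` is a contracting similarity on `ℝ` with scaling ratio `ρ`. -/
def IsSimilarityR (φ : ℝ → ℝ) (ρ : ℝ) : Prop :=
  ∀ x y, dist (φ x) (φ y) = ρ * dist x y

/-- The set of connected components of `U ⊆ ℝ`. -/
def componentsOf (U : Set ℝ) : Set (Set ℝ) :=
  {C | ∃ x ∈ U, C = connectedComponentIn U x}

/-- If every index is either one of finitely many seeds or a scaled copy of another index, then the
truncated sums of `ℓ ^ σ` are bounded uniformly in the truncation level. -/
theorem tsum_truncated_rpow_le {X ι κ : Type*} [Fintype ι] [Fintype κ] (e : κ ⊕ (ι × X) ≃ X)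
    {ℓ : X → ℝ} {r : ι → ℝ} {L σ : ℝ} (hr : ∀ j, 0 < r j)
    (hσ : ∑ j, r j ^ σ < 1) (hpos : ∀ x, 0 < ℓ x) (hle : ∀ x, ℓ x ≤ L)
    (he : ∀ j x, ℓ (e (Sum.inr (j, x))) = r j * ℓ x) (n : ℕ) :
    ∀ ε, L * (∑ j, r j) ^ n ≤ ε →
      ∑' x, (if ε < ℓ x then ENNReal.ofReal (ℓ x ^ σ) else 0) ≤
        ENNReal.ofReal ((∑ k, ℓ (e (Sum.inl k)) ^ σ) / (1 - ∑ j, r j ^ σ)) := by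
  have ha : 0 ≤ ∑ k, ℓ (e (Sum.inl k)) ^ σ :=
    Finset.sum_nonneg fun k _ => Real.rpow_nonneg (hpos _).le _
  have hb : 0 ≤ (∑ k, ℓ (e (Sum.inl k)) ^ σ) / (1 - ∑ j, r j ^ σ) :=
    div_nonneg ha (by linarith)
  have hrσ : ∀ j, 0 ≤ r j ^ σ := fun j => Real.rpow_nonneg (hr j).le _
  induction n with
  | zero =>
    intro ε hε
    have : ∀ x, ¬ ε < ℓ x := fun x => by have := hle x; simp at hε; linarith
    simp [this]
  | succ n ih =>
    intro ε hε
    rw [← e.tsum_eq, Summable.tsum_sum ENNReal.summable ENNReal.summable, tsum_fintype,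
      ENNReal.tsum_prod', tsum_fintype]
    set b := (∑ k, ℓ (e (Sum.inl k)) ^ σ) / (1 - ∑ j, r j ^ σ) with hbdef
    have h1 : ∑ k, (if ε < ℓ (e (Sum.inl k)) then
        ENNReal.ofReal (ℓ (e (Sum.inl k)) ^ σ) else 0) ≤
        ENNReal.ofReal (∑ k, ℓ (e (Sum.inl k)) ^ σ) := by
      rw [ENNReal.ofReal_sum_of_nonneg fun k _ => Real.rpow_nonneg (hpos _).le _]
      refine Finset.sum_le_sum fun k _ => ?_
      split_ifs <;> simp
    have h2 : ∀ j, ∑' x, (if ε < ℓ (e (Sum.inr (j, x))) then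
        ENNReal.ofReal (ℓ (e (Sum.inr (j, x))) ^ σ) else 0) ≤
        ENNReal.ofReal (r j ^ σ * b) := by
      intro j
      rcases isEmpty_or_nonempty X with hX | ⟨⟨x₀⟩⟩
      · simp
      have hL : 0 < L := (hpos x₀).trans_le (hle x₀)
      have hq : r j ≤ ∑ j, r j :=
        Finset.single_le_sum (f := r) (fun i _ => (hr i).le) (Finset.mem_univ j)
      have hq0 : 0 < ∑ j, r j := (hr j).trans_le hq
      have hε' : L * (∑ j, r j) ^ n ≤ ε / r j := by
        rw [le_div_iff₀ (hr j)]
        refine le_trans ?_ hε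
        rw [pow_succ, ← mul_assoc]
        gcongr
      rw [ENNReal.ofReal_mul (hrσ j)]
      refine le_trans (le_of_eq ?_) (mul_le_mul_right (ih _ hε') _)
      rw [← ENNReal.tsum_mul_left]
      refine tsum_congr fun x => ?_
      rw [he, Real.mul_rpow (hr j).le (hpos x).le, ENNReal.ofReal_mul (hrσ j)]
      simp only [div_lt_iff₀' (hr j)]
      split_ifs <;> simp
    refine (add_le_add h1 (Finset.sum_le_sum fun j _ => h2 j)).trans (le_of_eq ?_)
    rw [← ENNReal.ofReal_sum_of_nonneg fun j _ => mul_nonneg (hrσ j) hb,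
      ← ENNReal.ofReal_add ha (Finset.sum_nonneg fun j _ => mul_nonneg (hrσ j) hb),
      ← Finset.sum_mul]
    congr 1
    have : 1 - ∑ j, r j ^ σ ≠ 0 := by linarith
    rw [hbdef]
    field_simp
    ring

theorem summable_rpow_of_selfSimilar {X ι κ : Type*} [Fintype ι] [Fintype κ]
    (e : κ ⊕ (ι × X) ≃ X)
    {ℓ : X → ℝ} {r : ι → ℝ} {L σ : ℝ} (hr : ∀ j, 0 < r j) (hr1 : ∑ j, r j < 1)
    (hσ : ∑ j, r j ^ σ < 1) (hpos : ∀ x, 0 < ℓ x) (hle : ∀ x, ℓ x ≤ L)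
    (he : ∀ j x, ℓ (e (Sum.inr (j, x))) = r j * ℓ x) :
    Summable fun x => ℓ x ^ σ := by
  have hnn : ∀ x, 0 ≤ ℓ x ^ σ := fun x => Real.rpow_nonneg (hpos x).le _
  refine summable_of_sum_le
    (c := (∑ k, ℓ (e (Sum.inl k)) ^ σ) / (1 - ∑ j, r j ^ σ)) hnn fun u => ?_
  have hb : 0 ≤ (∑ k, ℓ (e (Sum.inl k)) ^ σ) / (1 - ∑ j, r j ^ σ) :=
    div_nonneg (Finset.sum_nonneg fun k _ => hnn _) (by linarith)
  have hq0 : 0 ≤ ∑ j, r j := Finset.sum_nonneg fun i _ => (hr i).le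
  have hlim : Tendsto (fun n : ℕ => L * (∑ j, r j) ^ n) atTop (𝓝 0) := by
    simpa using (tendsto_pow_atTop_nhds_zero_of_lt_one hq0 hr1).const_mul L
  have hev : ∀ᶠ n : ℕ in atTop, ∀ x ∈ u, L * (∑ j, r j) ^ n < ℓ x :=
    (Filter.eventually_all_finset u).2 fun x _ => hlim.eventually_lt_const (hpos x)
  obtain ⟨n, hn⟩ := hev.exists
  rw [← ENNReal.ofReal_le_ofReal_iff hb, ENNReal.ofReal_sum_of_nonneg fun x _ => hnn x]
  refine le_trans ?_ (tsum_truncated_rpow_le e hr hσ hpos hle he n _ le_rfl)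
  refine le_trans (le_of_eq ?_) (ENNReal.sum_le_tsum u)
  exact Finset.sum_congr rfl fun x hx => by rw [if_pos (hn x hx)]

theorem tsum_cpow_of_selfSimilar {X ι κ : Type*} [Fintype ι] [Fintype κ]
    (e : κ ⊕ (ι × X) ≃ X)
    {ℓ : X → ℝ} {r : ι → ℝ} {g : κ → ℝ} {L : ℝ} {s : ℂ} (hr : ∀ j, 0 < r j)
    (hr1 : ∑ j, r j < 1) (hσ : ∑ j, r j ^ s.re < 1) (hpos : ∀ x, 0 < ℓ x) (hle : ∀ x, ℓ x ≤ L)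
    (hL : 0 ≤ L) (hg : ∀ k, 0 ≤ g k) (heg : ∀ k, ℓ (e (Sum.inl k)) = g k * L)
    (he : ∀ j x, ℓ (e (Sum.inr (j, x))) = r j * ℓ x) :
    Summable (fun x => ‖(ℓ x : ℂ) ^ s‖) ∧
      ∑' x, (ℓ x : ℂ) ^ s =
        (L : ℂ) ^ s * (∑ k, (g k : ℂ) ^ s) / (1 - ∑ j, (r j : ℂ) ^ s) := by
  have hsum : Summable (fun x => ‖(ℓ x : ℂ) ^ s‖) := by
    simp only [Complex.norm_cpow_eq_rpow_re_of_pos (hpos _)]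
    exact summable_rpow_of_selfSimilar e hr hr1 hσ hpos hle he
  refine ⟨hsum, ?_⟩
  have hS : Summable (fun x => (ℓ x : ℂ) ^ s) := hsum.of_norm
  have hSe : Summable (fun y => (ℓ (e y) : ℂ) ^ s) := e.summable_iff.2 hS
  have hSr : Summable (fun p : ι × X => (ℓ (e (Sum.inr p)) : ℂ) ^ s) :=
    hSe.comp_injective Sum.inr_injective
  have key : ∑' x, (ℓ x : ℂ) ^ s =
      (L : ℂ) ^ s * (∑ k, (g k : ℂ) ^ s) + (∑ j, (r j : ℂ) ^ s) * ∑' x, (ℓ x : ℂ) ^ s := by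
    have h1 : ∑' x, (ℓ x : ℂ) ^ s = ∑' k, (ℓ (e (Sum.inl k)) : ℂ) ^ s +
        ∑' p : ι × X, (ℓ (e (Sum.inr p)) : ℂ) ^ s := by
      rw [← e.tsum_eq fun x => (ℓ x : ℂ) ^ s]
      exact Summable.tsum_sum (f := fun y => (ℓ (e y) : ℂ) ^ s) Summable.of_finite hSr
    have h2 : ∑' p : ι × X, (ℓ (e (Sum.inr p)) : ℂ) ^ s =
        ∑' j, ∑' x, (ℓ (e (Sum.inr (j, x))) : ℂ) ^ s := hSr.tsum_prod
    conv_lhs => rw [h1, h2, tsum_fintype, tsum_fintype]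
    rw [Finset.mul_sum, Finset.sum_mul]
    congr 1
    · refine Finset.sum_congr rfl fun k _ => ?_
      rw [heg, Complex.ofReal_mul, Complex.mul_cpow_ofReal_nonneg (hg k) hL, mul_comm]
    · refine Finset.sum_congr rfl fun j _ => ?_
      rw [← tsum_mul_left]
      refine tsum_congr fun x => ?_
      rw [he, Complex.ofReal_mul, Complex.mul_cpow_ofReal_nonneg (hr j).le (hpos x).le]
  have hne : 1 - ∑ j, (r j : ℂ) ^ s ≠ 0 := by
    intro h
    have h1 : ‖∑ j, (r j : ℂ) ^ s‖ ≤ ∑ j, r j ^ s.re :=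
      (norm_sum_le _ _).trans_eq
        (Finset.sum_congr rfl fun j _ => Complex.norm_cpow_eq_rpow_re_of_pos (hr j) s)
    rw [← sub_eq_zero.1 h, norm_one] at h1
    linarith
  rw [eq_div_iff hne]
  linear_combination key

/-- A similarity of the real line is affine. -/
theorem IsSimilarityR.exists_affine {f : ℝ → ℝ} {ρ : ℝ} (hf : IsSimilarityR f ρ) (hρ : 0 < ρ) :
    ∃ m c : ℝ, |m| = ρ ∧ ∀ x, f x = c + m * x := by
  have sq : ∀ x y, (f x - f y) ^ 2 = ρ ^ 2 * (x - y) ^ 2 := fun x y => by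
    rw [← sq_abs, ← sq_abs (x - y), ← Real.dist_eq, ← Real.dist_eq, hf, mul_pow]
  have h10 := sq 1 0
  have hm : f 1 - f 0 ≠ 0 := by
    intro h
    rw [h] at h10
    nlinarith [pow_pos hρ 2]
  refine ⟨f 1 - f 0, f 0, ?_, fun x => ?_⟩
  · have := hf 1 0
    rw [Real.dist_eq, Real.dist_eq] at this
    simpa using this
  · apply mul_left_cancel₀ hm
    linear_combination (1 / 2) * sq x 0 - (1 / 2) * sq x 1 + (1 / 2 - x) * h10

theorem IsSimilarityR.exists_homeomorph {f : ℝ → ℝ} {ρ : ℝ} (hf : IsSimilarityR f ρ)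
    (hρ : 0 < ρ) : ∃ h : ℝ ≃ₜ ℝ, ⇑h = f := by
  obtain ⟨m, c, hm, h⟩ := hf.exists_affine hρ
  have hm0 : m ≠ 0 := by rintro rfl; simp at hm; linarith
  exact ⟨(Homeomorph.mulLeft₀ m hm0).trans (Homeomorph.addLeft c), by ext x; simp [h]⟩

theorem IsSimilarityR.volume_image {f : ℝ → ℝ} {ρ : ℝ} (hf : IsSimilarityR f ρ)
    (hρ : 0 < ρ) (C : Set ℝ) : volume (f '' C) = ENNReal.ofReal ρ * volume C := by
  obtain ⟨m, c, hm, h⟩ := hf.exists_affine hρ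
  have : f '' C = (fun x => c + x) '' ((fun x => m • x) '' C) := by
    rw [Set.image_image]
    exact Set.image_congr fun x _ => by simp [h]
  rw [this, Set.image_add_left, measure_preimage_add, Set.image_smul, Measure.addHaar_smul]
  simp [hm]

theorem IsSimilarityR.image_Icc_subset {f : ℝ → ℝ} {ρ a b c d : ℝ} (hf : IsSimilarityR f ρ)
    (hρ : 0 < ρ) (ha : f a ∈ Set.Icc c d) (hb : f b ∈ Set.Icc c d) :
    f '' Set.Icc a b ⊆ Set.Icc c d := by
  obtain ⟨m, t, hm, h⟩ := hf.exists_affine hρ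
  rintro _ ⟨x, ⟨hx1, hx2⟩, rfl⟩
  simp only [h, Set.mem_Icc] at ha hb ⊢
  rcases le_total 0 m with h0 | h0 <;> constructor <;> nlinarith

/-- A connected component of a union of pairwise disjoint open sets is a component of one of
the pieces. -/
theorem connectedComponentIn_iUnion_of_disjoint {X ι : Type*} [TopologicalSpace X] {U : ι → Set X}
    (hU : ∀ i, IsOpen (U i)) (hd : Pairwise fun i j => Disjoint (U i) (U j)) {i : ι} {x : X}
    (hx : x ∈ U i) : connectedComponentIn (⋃ i, U i) x = connectedComponentIn (U i) x := by
  have hxU : x ∈ ⋃ i, U i := Set.mem_iUnion_of_mem i hx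
  refine Set.Subset.antisymm ?_ (connectedComponentIn_mono x (Set.subset_iUnion U i))
  refine isPreconnected_connectedComponentIn.subset_connectedComponentIn
    (mem_connectedComponentIn hxU) ?_
  refine isPreconnected_connectedComponentIn.subset_left_of_subset_union (hU i)
    (isOpen_iUnion fun j => isOpen_iUnion fun _ : j ≠ i => hU j) ?_ ?_
    ⟨x, mem_connectedComponentIn hxU, hx⟩
  · simp only [Set.disjoint_iUnion_right]
    exact fun j hj => hd hj.symm
  · refine (connectedComponentIn_subset _ _).trans fun y hy => ?_
    obtain ⟨j, hj⟩ := Set.mem_iUnion.1 hy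
    by_cases hji : j = i
    · exact Or.inl (hji ▸ hj)
    · exact Or.inr (Set.mem_iUnion₂.2 ⟨j, hji, hj⟩)

theorem componentsOf_nonempty {U C : Set ℝ} (hC : C ∈ componentsOf U) : C.Nonempty := by
  obtain ⟨x, hx, rfl⟩ := hC
  exact ⟨x, mem_connectedComponentIn hx⟩

theorem componentsOf_subset {U C : Set ℝ} (hC : C ∈ componentsOf U) : C ⊆ U := by
  obtain ⟨x, hx, rfl⟩ := hC
  exact connectedComponentIn_subset _ _

theorem volume_pos_of_mem_componentsOf {U C : Set ℝ} (hU : IsOpen U) (hC : C ∈ componentsOf U) :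
    0 < volume C := by
  have hne := componentsOf_nonempty hC
  obtain ⟨x, hx, rfl⟩ := hC
  exact hU.connectedComponentIn.measure_pos volume hne

theorem image_mem_componentsOf (h : ℝ ≃ₜ ℝ) {U C : Set ℝ} (hC : C ∈ componentsOf U) :
    h '' C ∈ componentsOf (h '' U) := by
  obtain ⟨x, hx, rfl⟩ := hC
  exact ⟨h x, Set.mem_image_of_mem h hx, h.image_connectedComponentIn hx⟩

theorem mem_componentsOf_image (h : ℝ ≃ₜ ℝ) {U C : Set ℝ} (hC : C ∈ componentsOf (h '' U)) :
    ∃ B ∈ componentsOf U, h '' B = C := by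
  obtain ⟨_, ⟨x, hx, rfl⟩, rfl⟩ := hC
  exact ⟨_, ⟨x, hx, rfl⟩, h.image_connectedComponentIn hx⟩

theorem mem_componentsOf_iUnion {ι : Type*} {U : ι → Set ℝ} (hU : ∀ i, IsOpen (U i))
    (hd : Pairwise fun i j => Disjoint (U i) (U j)) {C : Set ℝ} :
    C ∈ componentsOf (⋃ i, U i) ↔ ∃ i, C ∈ componentsOf (U i) := by
  constructor
  · rintro ⟨x, hx, rfl⟩
    obtain ⟨i, hi⟩ := Set.mem_iUnion.1 hx
    exact ⟨i, x, hi, connectedComponentIn_iUnion_of_disjoint hU hd hi⟩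
  · rintro ⟨i, x, hx, rfl⟩
    exact ⟨x, Set.mem_iUnion_of_mem i hx,
      (connectedComponentIn_iUnion_of_disjoint hU hd hx).symm⟩

/-- The components of a disjoint union of an open set `G` and homeomorphic copies of the union
itself, indexed by the components of `G` and pairs of a copy and a component. -/
theorem exists_componentsOf_equiv {ι κ : Type*} {W G : Set ℝ} (h : ι → ℝ ≃ₜ ℝ) (hG : IsOpen G)
    (hW : IsOpen W) (hunion : W = G ∪ ⋃ j, h j '' W) (hdG : ∀ j, Disjoint G (h j '' W))
    (hd : Pairwise fun i j => Disjoint (h i '' W) (h j '' W)) (eg : κ ≃ componentsOf G) :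
    ∃ e : κ ⊕ (ι × componentsOf W) ≃ componentsOf W,
      (∀ k, (e (Sum.inl k) : Set ℝ) = eg k) ∧
      ∀ j C, (e (Sum.inr (j, C)) : Set ℝ) = h j '' C := by
  let U : Option ι → Set ℝ := fun o => o.elim G fun j => h j '' W
  have hU : ∀ o, IsOpen (U o) := by
    rintro (_ | j)
    · exact hG
    · exact (h j).isOpenMap _ hW
  have hUd : Pairwise fun i j => Disjoint (U i) (U j) := by
    rintro (_ | i) (_ | j) hij
    · exact absurd rfl hij
    · exact hdG j
    · exact (hdG i).symm
    · exact hd fun hij' => hij (congrArg some hij')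
  have hWU : W = ⋃ o, U o := by rw [Set.iUnion_option]; exact hunion
  have hmem : ∀ C, C ∈ componentsOf W ↔ ∃ o, C ∈ componentsOf (U o) := fun C => by
    conv_lhs => rw [hWU]
    exact mem_componentsOf_iUnion hU hUd
  have huniq : ∀ {C o o'}, C ∈ componentsOf (U o) → C ∈ componentsOf (U o') → o = o' := by
    intro C o o' ho ho'
    by_contra hne
    obtain ⟨x, hx⟩ := componentsOf_nonempty ho
    exact Set.disjoint_left.1 (hUd hne) (componentsOf_subset ho hx) (componentsOf_subset ho' hx)
  let f : κ ⊕ (ι × componentsOf W) → componentsOf W := Sum.elim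
    (fun k => ⟨eg k, (hmem _).2 ⟨none, (eg k).2⟩⟩)
    (fun p => ⟨h p.1 '' p.2, (hmem _).2 ⟨some p.1, image_mem_componentsOf _ p.2.2⟩⟩)
  have hf : Function.Bijective f := by
    constructor
    · rintro (k | ⟨i, B⟩) (l | ⟨j, C⟩) hkl
      · rw [eg.injective (Subtype.ext (congrArg (fun C : componentsOf W => (C : Set ℝ)) hkl))]
      · have hkl : (eg k : Set ℝ) = h j '' C := Subtype.ext_iff.1 hkl
        have := huniq (o := none) (o' := some j) (eg k).2
          (hkl ▸ image_mem_componentsOf (h j) C.2)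
        cases this
      · have hkl : h i '' B = (eg l : Set ℝ) := Subtype.ext_iff.1 hkl
        have := huniq (o := none) (o' := some i) (eg l).2
          (hkl ▸ image_mem_componentsOf (h i) B.2)
        cases this
      · have hkl : h i '' B = h j '' C := Subtype.ext_iff.1 hkl
        have hij := huniq (o := some i) (o' := some j) (image_mem_componentsOf (h i) B.2)
          (hkl ▸ image_mem_componentsOf (h j) C.2)
        cases hij
        rw [Subtype.ext ((h i).injective.image_injective hkl)]
    · rintro ⟨C, hC⟩
      obtain ⟨_ | j, ho⟩ := (hmem C).1 hC
      · exact ⟨Sum.inl (eg.symm ⟨C, ho⟩), Subtype.ext (by simp [f])⟩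
      · obtain ⟨B, hB, rfl⟩ := mem_componentsOf_image (h j) ho
        exact ⟨Sum.inr (j, ⟨B, hB⟩), rfl⟩
  exact ⟨Equiv.ofBijective f hf, fun k => rfl, fun j C => rfl⟩

/-- Geometric zeta function of a self-similar string: for a self-similar system on `ℝ`
satisfying the open set condition, with attractor `F`, scaling ratios summing to less than
`1`, `I = [inf F, sup F]`, `L = sup F - inf F`, `Ω = I \ F`, gaps `g₁,…,g_K`, and similarity
dimension `D`, one has for `Re s > D` that the series `∑_J (length J)^s` over the connected
components `J` of `Ω` converges absolutely, with sum
`L^s (∑ g_k^s) / (1 - ∑ r_j^s)`. -/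
theorem stmt5 {N K : ℕ} (hN : 2 ≤ N)
    (φ : Fin N → ℝ → ℝ) (r : Fin N → ℝ) (hr : ∀ j, r j ∈ Set.Ioo (0 : ℝ) 1)
    (hsim : ∀ j, IsSimilarityR (φ j) (r j))
    (hOSC : ∃ V : Set ℝ, V.Nonempty ∧ IsOpen V ∧ (∀ j, φ j '' V ⊆ V) ∧
      Pairwise fun i j => Disjoint (φ i '' V) (φ j '' V))
    (F : Set ℝ) (hFne : F.Nonempty) (hFc : IsCompact F) (hFinv : F = ⋃ j, φ j '' F)
    (hrsum : ∑ j, r j < 1)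
    (I : Set ℝ) (hI : I = Set.Icc (sInf F) (sSup F))
    (L : ℝ) (hL : L = sSup F - sInf F) (hLpos : 0 < L)
    (Ω : Set ℝ) (hΩ : Ω = I \ F)
    (hdisjI : Pairwise fun i j => Disjoint (interior (φ i '' I)) (interior (φ j '' I)))
    (g : Fin K → ℝ) (hg : ∀ k, 0 < g k)
    (eg : Fin K ≃ {C : Set ℝ // C ∈ componentsOf (I \ ⋃ j, φ j '' I) ∧ 0 < volume C})
    (hgL : ∀ k, (volume ((eg k : Set ℝ))).toReal = g k * L)
    (hgsum : ∑ k, g k + ∑ j, r j = 1)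
    (D : ℝ) (hD : ∑ j, r j ^ D = 1) :
    ∀ s : ℂ, D < s.re →
      Summable (fun C : componentsOf Ω => ‖(((volume (C : Set ℝ)).toReal : ℂ)) ^ s‖) ∧
      ∑' C : componentsOf Ω, (((volume (C : Set ℝ)).toReal : ℂ)) ^ s =
        (L : ℂ) ^ s * (∑ k, ((g k : ℂ)) ^ s) / (1 - ∑ j, ((r j : ℂ)) ^ s) := by
  intro s hs
  have hr0 : ∀ j, 0 < r j := fun j => (hr j).1
  choose h hh using fun j => (hsim j).exists_homeomorph (hr0 j)
  have ha : sInf F ∈ F := hFc.sInf_mem hFne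
  have hb : sSup F ∈ F := hFc.sSup_mem hFne
  have hab : sInf F < sSup F := by linarith
  have hFI : F ⊆ I := fun x hx =>
    hI ▸ ⟨csInf_le hFc.bddBelow hx, le_csSup hFc.bddAbove hx⟩
  have hφF : ∀ j, ∀ x ∈ F, φ j x ∈ F := fun j x hx => by
    rw [hFinv]; exact Set.mem_iUnion_of_mem j (Set.mem_image_of_mem _ hx)
  have hφI : ∀ j, φ j '' I ⊆ I := fun j => by
    rw [hI]
    exact (hsim j).image_Icc_subset (hr0 j) (hI ▸ hFI (hφF j _ ha)) (hI ▸ hFI (hφF j _ hb))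
  have hFsub : F ⊆ ⋃ j, φ j '' I := by
    intro x hx
    rw [hFinv] at hx
    exact Set.iUnion_mono (fun j => Set.image_mono hFI) hx
  have hIc : IsCompact I := hI ▸ isCompact_Icc
  have hopen : ∀ A, IsClosed A → F ⊆ A → IsOpen (I \ A) ∧ I \ A ⊆ interior I := by
    intro A hA hFA
    have : I \ A = Set.Ioo (sInf F) (sSup F) \ A := by
      ext x
      simp only [hI, Set.mem_sdiff, Set.mem_Icc, Set.mem_Ioo]
      refine ⟨fun ⟨⟨h1, h2⟩, h3⟩ => ⟨⟨lt_of_le_of_ne h1 ?_, lt_of_le_of_ne h2 ?_⟩, h3⟩,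
        fun ⟨⟨h1, h2⟩, h3⟩ => ⟨⟨h1.le, h2.le⟩, h3⟩⟩
      · rintro rfl; exact h3 (hFA ha)
      · rintro rfl; exact h3 (hFA hb)
    have ho : IsOpen (I \ A) := this ▸ isOpen_Ioo.sdiff hA
    exact ⟨ho, interior_maximal Set.sdiff_subset ho⟩
  have hUc : IsClosed (⋃ j, φ j '' I) := isClosed_iUnion_of_finite fun j => by
    rw [← hh j]
    exact (hIc.image (h j).continuous).isClosed
  obtain ⟨hGo, -⟩ := hopen _ hUc hFsub
  obtain ⟨hΩo, hΩint⟩ := hopen F hFc.isClosed le_rfl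
  rw [← hΩ] at hΩo hΩint
  have hΩI : Ω ⊆ I := hΩ ▸ Set.sdiff_subset
  have hIcl : I ⊆ closure (interior I) := by
    rw [hI, interior_Icc, closure_Ioo hab.ne]
  have himint : ∀ j, φ j '' Ω ⊆ interior (φ j '' I) := fun j => by
    rw [← hh j, ← (h j).image_interior]
    exact Set.image_mono hΩint
  have himF : ∀ j, ∀ x ∈ Ω, φ j x ∉ F := by
    intro j x hx hxF
    rw [hFinv] at hxF
    obtain ⟨i, z, hz, hzx⟩ := Set.mem_iUnion.1 hxF
    by_cases hij : i = j
    · subst hij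
      rw [← hh i] at hzx
      rw [hΩ] at hx
      exact hx.2 ((h i).injective hzx ▸ hz)
    · have hcl : φ i z ∈ closure (interior (φ i '' I)) := by
        rw [← hh i, ← (h i).image_interior, ← (h i).image_closure]
        exact Set.mem_image_of_mem _ (hIcl (hFI hz))
      obtain ⟨y, hy1, hy2⟩ := mem_closure_iff.1 hcl _ isOpen_interior
        (hzx ▸ himint j (Set.mem_image_of_mem _ hx))
      exact Set.disjoint_left.1 (hdisjI hij) hy2 hy1
  have hunion : Ω = (I \ ⋃ j, φ j '' I) ∪ ⋃ j, h j '' Ω := by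
    simp only [hh]
    ext x
    constructor
    · intro hx
      by_cases hxU : x ∈ ⋃ j, φ j '' I
      · obtain ⟨j, y, hy, rfl⟩ := Set.mem_iUnion.1 hxU
        refine Or.inr (Set.mem_iUnion_of_mem j ⟨y, ?_, rfl⟩)
        rw [hΩ] at hx ⊢
        exact ⟨hy, fun hyF => hx.2 (hφF j y hyF)⟩
      · exact Or.inl ⟨hΩI hx, hxU⟩
    · rintro (⟨hxI, hxU⟩ | hx)
      · exact hΩ ▸ ⟨hxI, fun hxF => hxU (hFsub hxF)⟩
      · obtain ⟨j, y, hy, rfl⟩ := Set.mem_iUnion.1 hx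
        exact hΩ.symm.subset ⟨hφI j (Set.mem_image_of_mem _ (hΩI hy)), himF j y hy⟩
  have hdG : ∀ j, Disjoint (I \ ⋃ j, φ j '' I) (h j '' Ω) := fun j => by
    rw [hh, Set.disjoint_left]
    exact fun x hx hx' => hx.2 (Set.mem_iUnion_of_mem j (Set.image_mono hΩI hx'))
  have hd : Pairwise fun i j => Disjoint (h i '' Ω) (h j '' Ω) := fun i j hij => by
    simp only [hh]
    exact (hdisjI hij).mono (himint i) (himint j)
  obtain ⟨e, he1, he2⟩ := exists_componentsOf_equiv h hGo hΩo hunion hdG hd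
    (eg.trans (Equiv.subtypeEquivRight fun C =>
      ⟨fun hC => hC.1, fun hC => ⟨hC, volume_pos_of_mem_componentsOf hGo hC⟩⟩))
  have hvI : volume I = ENNReal.ofReal L := by rw [hI, Real.volume_Icc, hL]
  have hCle : ∀ C : componentsOf Ω, volume (C : Set ℝ) ≤ ENNReal.ofReal L := fun C =>
    hvI ▸ measure_mono ((componentsOf_subset C.2).trans hΩI)
  have hσ : ∑ j, r j ^ s.re < 1 := by
    rw [← hD]
    refine Finset.sum_lt_sum_of_nonempty ⟨⟨0, by omega⟩, Finset.mem_univ _⟩ fun j _ => ?_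
    exact Real.rpow_lt_rpow_of_exponent_gt (hr j).1 (hr j).2 hs
  refine tsum_cpow_of_selfSimilar e (ℓ := fun C => (volume (C : Set ℝ)).toReal) hr0 hrsum hσ
    (fun C => ENNReal.toReal_pos (volume_pos_of_mem_componentsOf hΩo C.2).ne'
      (ne_top_of_le_ne_top ENNReal.ofReal_ne_top (hCle C)))
    (fun C => ENNReal.toReal_le_of_le_ofReal hLpos.le (hCle C)) hLpos.le (fun k => (hg k).le)
    (fun k => ?_) (fun j C => ?_)
  · rw [he1]
    exact hgL k
  · rw [he2, hh, (hsim j).volume_image (hr0 j), ENNReal.toReal_mul,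
      ENNReal.toReal_ofReal (hr0 j).le]
end

section
/- Let r = (r_1,…,r_N) be a lattice scaling vector (N ≥ 2), say r_j = r^{k_j} with r ∈ (0,1) and positive integers k_1,…,k_N satisfying gcd(k_1,…,k_N) = 1, and set p := 2π/log(1/r). Then S_r is invariant under translation by ip (ω ∈ S_r if and only if ω + ip ∈ S_r), and there exist finitely many complex numbers ω_1,…,ω_q with 0 ≤ Im(ω_t) < p such that S_r = {ω_t + inp : n ∈ ℤ, 1 ≤ t ≤ q}. -/
open Filter Topology

/-- The set of complex solutions of the Moran equation `∑ r_j^s = 1`. -/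
def MoranSet {N : ℕ} (r : Fin N → ℝ) : Set ℂ :=
  {s : ℂ | ∑ j, ((r j : ℂ)) ^ s = 1}

open Polynomial in
lemma polynomial_sum_X_pow_sub_one_ne_zero {ι R : Type*} [CommRing R] [Nontrivial R]
    (s : Finset ι) (k : ι → ℕ) (hk : ∀ j ∈ s, 0 < k j) :
    (∑ j ∈ s, (X : R[X]) ^ k j - 1) ≠ 0 := by
  intro h
  have h0 := congrArg (Polynomial.eval 0) h
  have hz : ∑ j ∈ s, (0 : R) ^ k j = 0 :=
    Finset.sum_eq_zero fun j hj => zero_pow (hk j hj).ne'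
  simp [Polynomial.eval_finsetSum, hz] at h0

lemma ofReal_pow_cpow_eq_exp_pow {ρ : ℝ} (hρ : 0 < ρ) (n : ℕ) (s : ℂ) :
    ((ρ ^ n : ℝ) : ℂ) ^ s = Complex.exp (Real.log ρ * s) ^ n := by
  have hne : ((ρ ^ n : ℝ) : ℂ) ≠ 0 := by exact_mod_cast (pow_pos hρ n).ne'
  rw [Complex.cpow_def_of_ne_zero hne, ← Complex.ofReal_log (pow_pos hρ n).le, Real.log_pow,
    ← Complex.exp_nat_mul]
  congr 1
  push_cast
  ring

lemma mem_moranSet_iff_of_lattice {N : ℕ} {r : Fin N → ℝ} {ρ : ℝ} (hρ : 0 < ρ)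
    {k : Fin N → ℕ} (hrk : ∀ j, r j = ρ ^ k j) (s : ℂ) :
    s ∈ MoranSet r ↔ ∑ j, Complex.exp (Real.log ρ * s) ^ k j = 1 := by
  simp only [MoranSet, Set.mem_ofPred_eq, hrk, ofReal_pow_cpow_eq_exp_pow hρ]

lemma exp_mul_eq_exp_mul_iff_of_mul_eq {L p : ℝ} (hL : L ≠ 0) (hpL : L * p = -(2 * Real.pi))
    (s t : ℂ) :
    Complex.exp (L * s) = Complex.exp (L * t) ↔ ∃ n : ℤ, s = t + n * p * Complex.I := by
  have hL' : (L : ℂ) ≠ 0 := by exact_mod_cast hL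
  have hpL' : (L : ℂ) * p = -(2 * Real.pi) := by exact_mod_cast hpL
  rw [Complex.exp_eq_exp_iff_exists_int]
  constructor
  · rintro ⟨n, hn⟩
    refine ⟨-n, mul_left_cancel₀ hL' ?_⟩
    push_cast
    linear_combination hn + n * Complex.I * hpL'
  · rintro ⟨n, rfl⟩
    refine ⟨-n, ?_⟩
    push_cast
    linear_combination n * Complex.I * hpL'

lemma finite_moranSet_inter_strip {N : ℕ} {r : Fin N → ℝ} {ρ : ℝ} (hρ : 0 < ρ)
    {k : Fin N → ℕ} (hk : ∀ j, 0 < k j) (hrk : ∀ j, r j = ρ ^ k j) {p : ℝ}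
    (hL : Real.log ρ ≠ 0) (hpL : Real.log ρ * p = -(2 * Real.pi)) :
    (MoranSet r ∩ {s | 0 ≤ s.im ∧ s.im < p}).Finite := by
  have hP := polynomial_sum_X_pow_sub_one_ne_zero (R := ℂ) Finset.univ k fun j _ => hk j
  refine Set.Finite.of_finite_image
    (f := fun s : ℂ => Complex.exp (Real.log ρ * s)) ((Polynomial.finite_setOfPred_isRoot hP).subset ?_)
    ?_
  · rintro _ ⟨s, ⟨hs, -⟩, rfl⟩
    rw [mem_moranSet_iff_of_lattice hρ hrk] at hs
    simp [Polynomial.IsRoot, Polynomial.eval_finsetSum, hs]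
  · rintro s ⟨-, hs0, hsp⟩ t ⟨-, ht0, htp⟩ hst
    obtain ⟨n, rfl⟩ := (exp_mul_eq_exp_mul_iff_of_mul_eq hL hpL s t).1 hst
    have hp : 0 < p := ht0.trans_lt htp
    simp only [Complex.add_im, Complex.mul_im, Complex.mul_re, Complex.I_re, Complex.I_im,
      Complex.intCast_re, Complex.intCast_im, Complex.ofReal_re, Complex.ofReal_im] at hs0 hsp
    have h1 : (n : ℝ) < 1 := by
      by_contra! h
      nlinarith
    have h2 : (-1 : ℝ) < n := by
      by_contra! h
      nlinarith
    have h1' : n < 1 := by exact_mod_cast h1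
    have h2' : -1 < n := by exact_mod_cast h2
    obtain rfl : n = 0 := by omega
    simp

/-- For a lattice scaling vector `r`, with `r j = ρ ^ (k j)`, `gcd k = 1`, and oscillatory
period `p = 2π / log(1/ρ)`: the solution set `S_r` of the Moran equation is invariant under
translation by `i p`, and there are finitely many `ω₁,…,ω_q` with imaginary parts in `[0,p)`
such that `S_r = {ω_t + i n p : n ∈ ℤ, 1 ≤ t ≤ q}`. -/
theorem stmt7 {N : ℕ} (hN : 2 ≤ N) (r : Fin N → ℝ)
    (ρ : ℝ) (hρ : ρ ∈ Set.Ioo (0 : ℝ) 1)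
    (k : Fin N → ℕ) (hk : ∀ j, 0 < k j) (hgcd : Finset.univ.gcd k = 1)
    (hrk : ∀ j, r j = ρ ^ (k j))
    (p : ℝ) (hp : p = 2 * Real.pi / Real.log (1 / ρ)) :
    (∀ ω : ℂ, ω ∈ MoranSet r ↔ ω + (p : ℂ) * Complex.I ∈ MoranSet r) ∧
    ∃ (q : ℕ) (ω : Fin q → ℂ),
      (∀ t, 0 ≤ (ω t).im ∧ (ω t).im < p) ∧
      MoranSet r = {z : ℂ | ∃ (n : ℤ) (t : Fin q), z = ω t + (n : ℂ) * (p : ℂ) * Complex.I} := by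
  obtain ⟨hρ0, hρ1⟩ := hρ
  have hlog : Real.log ρ < 0 := Real.log_neg hρ0 hρ1
  have hL : Real.log ρ ≠ 0 := hlog.ne
  have hpL : Real.log ρ * p = -(2 * Real.pi) := by
    rw [hp, one_div, Real.log_inv]
    field_simp
  have hp0 : 0 < p := by
    rw [hp, one_div, Real.log_inv]
    exact div_pos (by positivity) (by linarith)
  have hper : ∀ (s : ℂ) (n : ℤ), s + n * p * Complex.I ∈ MoranSet r ↔ s ∈ MoranSet r := by
    intro s n
    rw [mem_moranSet_iff_of_lattice hρ0 hrk, mem_moranSet_iff_of_lattice hρ0 hrk,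
      (exp_mul_eq_exp_mul_iff_of_mul_eq hL hpL _ s).2 ⟨n, rfl⟩]
  refine ⟨fun ω => by simpa using (hper ω 1).symm, ?_⟩
  obtain ⟨q, ω, hω⟩ := (finite_moranSet_inter_strip hρ0 hk hrk hL hpL).fin_param
  have hmem : ∀ t, ω t ∈ MoranSet r ∩ {s | 0 ≤ s.im ∧ s.im < p} := fun t =>
    hω.2 ▸ Set.mem_range_self t
  refine ⟨q, ω, fun t => (hmem t).2, Set.ext fun z => ⟨fun hz => ?_, ?_⟩⟩
  · have hz' : z + (-⌊z.im / p⌋ : ℤ) * p * Complex.I ∈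
        MoranSet r ∩ {s | 0 ≤ s.im ∧ s.im < p} := by
      refine ⟨(hper z _).2 hz, ?_⟩
      have h1 := (le_div_iff₀ hp0).1 (Int.floor_le (z.im / p))
      have h2 := (div_lt_iff₀ hp0).1 (Int.lt_floor_add_one (z.im / p))
      simp only [Set.mem_ofPred_eq, Complex.add_im, Complex.mul_im, Complex.mul_re, Complex.I_re,
        Complex.I_im, Complex.intCast_re, Complex.intCast_im, Complex.ofReal_re,
        Complex.ofReal_im]
      push_cast
      constructor <;> linarith
    rw [← hω.2] at hz'
    obtain ⟨t, ht⟩ := hz'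
    refine ⟨⌊z.im / p⌋, t, ?_⟩
    rw [ht]
    push_cast
    ring
  · rintro ⟨n, t, rfl⟩
    exact (hper _ n).2 (hmem t).1
end

section
/- Let r = (r_1,…,r_N) be a nonlattice scaling vector (N ≥ 2, all r_j ∈ (0,1)). Then D_r ∈ S_r; every ω ∈ S_r with ω ≠ D_r satisfies Re(ω) < D_r; and there exists a sequence (ω_n) of elements of S_r with Re(ω_n) < D_r for all n and Re(ω_n) → D_r as n → ∞. -/
open Filter Topology

open Finset in
/-- If all `log (r j)` are integer multiples of a common period, then `r` is lattice. -/
lemma isLatticeVec_of_log_mul_eq {N : ℕ} (hN : 0 < N) {r : Fin N → ℝ}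
    (hr : ∀ j, r j ∈ Set.Ioo (0 : ℝ) 1) {t : ℝ} (ht : t ≠ 0)
    (h : ∀ j, ∃ n : ℤ, n * (2 * Real.pi) = Real.log (r j) * t) : IsLatticeVec r := by
  choose n hn using h
  have hlog (j) : Real.log (r j) < 0 := Real.log_neg (hr j).1 (hr j).2
  have hn0 (j) : n j ≠ 0 := by
    intro h0
    have := hn j
    rw [h0, Int.cast_zero, zero_mul] at this
    exact mul_ne_zero (hlog j).ne ht this.symm
  set m : Fin N → ℕ := fun j => (n j).natAbs with hm
  have hm0 (j) : m j ≠ 0 := Int.natAbs_ne_zero.mpr (hn0 j)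
  have hmlog (j) : Real.log (r j) = -(m j * (2 * Real.pi) / |t|) := by
    have h1 : (m j : ℝ) = |(n j : ℝ)| := by simp [hm, Nat.cast_natAbs]
    have h2 := congrArg abs (hn j)
    rw [abs_mul, abs_mul (Real.log _), abs_of_neg (hlog j), abs_of_pos Real.two_pi_pos,
      ← h1] at h2
    rw [h2, mul_div_cancel_right₀ _ (abs_ne_zero.mpr ht), neg_neg]
  set g := univ.gcd m with hg
  have hg0 : 0 < g := Nat.pos_of_ne_zero fun h0 =>
    hm0 ⟨0, hN⟩ (Finset.gcd_eq_zero_iff.mp h0 _ (mem_univ _))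
  have hdvd (j) : g ∣ m j := Finset.gcd_dvd (mem_univ j)
  refine ⟨Real.exp (-(g * (2 * Real.pi) / |t|)), fun j => m j / g, ⟨Real.exp_pos _, ?_⟩,
    fun j => Nat.div_pos (Nat.le_of_dvd (Nat.pos_of_ne_zero (hm0 j)) (hdvd j)) hg0,
    Finset.gcd_div_eq_one (mem_univ (⟨0, hN⟩ : Fin N)) (hm0 _), fun j => ?_⟩
  · have := abs_pos.mpr ht
    have := Real.pi_pos
    have : (0 : ℝ) < g := by exact_mod_cast hg0
    rw [Real.exp_lt_one_iff]
    simp only [Left.neg_neg_iff]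
    positivity
  · rw [← Real.exp_nat_mul, ← Real.exp_log (hr j).1, hmlog]
    congr 1
    have : (m j : ℝ) = (m j / g : ℕ) * g := by exact_mod_cast (Nat.div_mul_cancel (hdvd j)).symm
    rw [this]
    ring

/-- A finite family of unimodular characters of `ℝ` returns simultaneously close to `1`
at some time `t ≥ 1`. -/
lemma exists_one_le_forall_norm_cpow_mul_I_sub_one_lt {ι : Type*} [Fintype ι] {r : ι → ℝ}
    (hr : ∀ j, 0 < r j) {η : ℝ} (hη : 0 < η) :
    ∃ t : ℝ, 1 ≤ t ∧ ∀ j, ‖(r j : ℂ) ^ (t * Complex.I) - 1‖ < η := by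
  have hnorm (j) (t : ℝ) : ‖(r j : ℂ) ^ (t * Complex.I)‖ = 1 := by
    simp [Complex.norm_cpow_eq_rpow_re_of_pos (hr j)]
  let x : ℕ → ι → ℂ := fun n j => (r j : ℂ) ^ (((n : ℝ) : ℂ) * Complex.I)
  have hx (n) : x n ∈ Metric.closedBall (0 : ι → ℂ) 1 := by
    rw [mem_closedBall_zero_iff, pi_norm_le_iff_of_nonneg zero_le_one]
    exact fun j => (hnorm j n).le
  obtain ⟨a, -, φ, hφ, hlim⟩ := (isCompact_closedBall (0 : ι → ℂ) 1).tendsto_subseq hx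
  obtain ⟨M, hM⟩ := Metric.cauchySeq_iff.mp hlim.cauchySeq η hη
  have hd := hM (M + 1) (by simp) M le_rfl
  have hlt : φ M + 1 ≤ φ (M + 1) := hφ (Nat.lt_succ_self M)
  have hlt' : (φ M : ℝ) + 1 ≤ φ (M + 1) := by exact_mod_cast hlt
  refine ⟨φ (M + 1) - φ M, by linarith, fun j => ?_⟩
  have h1 : dist (x (φ (M + 1)) j) (x (φ M) j) < η := (dist_le_pi_dist _ _ j).trans_lt hd
  have h2 : x (φ (M + 1)) j - x (φ M) j = x (φ M) j *
      ((r j : ℂ) ^ (((φ (M + 1) - φ M : ℝ) : ℂ) * Complex.I) - 1) := by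
    rw [mul_sub, mul_one, ← Complex.cpow_add _ _ (by exact_mod_cast (hr j).ne')]
    simp only [x]
    congr 2
    push_cast
    ring
  rwa [dist_eq_norm, h2, norm_mul, hnorm j, one_mul] at h1

/-- The real part of an element of `MoranSet r` is at most the similarity dimension. -/
lemma re_le_of_mem_moranSet {N : ℕ} (hN : 0 < N) {r : Fin N → ℝ}
    (hr : ∀ j, r j ∈ Set.Ioo (0 : ℝ) 1) {D : ℝ} (hD : ∑ j, r j ^ D = 1) {ω : ℂ}
    (hω : ω ∈ MoranSet r) : ω.re ≤ D := by
  by_contra! hlt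
  have h1 : (1 : ℝ) ≤ ∑ j, r j ^ ω.re := by
    calc (1 : ℝ) = ‖∑ j, (r j : ℂ) ^ ω‖ := by rw [show ∑ j, (r j : ℂ) ^ ω = 1 from hω, norm_one]
      _ ≤ ∑ j, ‖(r j : ℂ) ^ ω‖ := norm_sum_le _ _
      _ = ∑ j, r j ^ ω.re :=
        Finset.sum_congr rfl fun j _ => Complex.norm_cpow_eq_rpow_re_of_pos (hr j).1 _
  have h2 : ∑ j, r j ^ ω.re < ∑ j, r j ^ D :=
    Finset.sum_lt_sum_of_nonempty ⟨⟨0, hN⟩, Finset.mem_univ _⟩ fun j _ =>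
      Real.rpow_lt_rpow_of_exponent_gt (hr j).1 (hr j).2 hlt
  linarith

/-- If the Moran equation has a nonreal solution on the critical line, then `r` is lattice. -/
lemma isLatticeVec_of_mem_moranSet {N : ℕ} (hN : 0 < N) {r : Fin N → ℝ}
    (hr : ∀ j, r j ∈ Set.Ioo (0 : ℝ) 1) {D : ℝ} (hD : ∑ j, r j ^ D = 1) {ω : ℂ}
    (hω : ω ∈ MoranSet r) (hre : ω.re = D) (him : ω.im ≠ 0) : IsLatticeVec r := by
  have hcos (j) : ((r j : ℂ) ^ ω).re = r j ^ D * Real.cos (Real.log (r j) * ω.im) := by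
    rw [Complex.cpow_def_of_ne_zero (by exact_mod_cast (hr j).1.ne'),
      ← Complex.ofReal_log (hr j).1.le, Complex.exp_re, Complex.re_ofReal_mul,
      Complex.im_ofReal_mul, hre, Real.rpow_def_of_pos (hr j).1]
  have hsum : ∑ j, r j ^ D * (1 - Real.cos (Real.log (r j) * ω.im)) = 0 := by
    have h1 := congrArg Complex.re (show ∑ j, (r j : ℂ) ^ ω = 1 from hω)
    simp only [Complex.re_sum, hcos, Complex.one_re] at h1
    simp only [mul_sub, mul_one, Finset.sum_sub_distrib, h1, hD, sub_self]
  refine isLatticeVec_of_log_mul_eq hN hr him fun j => ?_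
  have h0 := (Finset.sum_eq_zero_iff_of_nonneg fun j _ =>
    mul_nonneg (Real.rpow_nonneg (hr j).1.le D)
      (sub_nonneg.mpr (Real.cos_le_one (Real.log (r j) * ω.im)))).mp hsum j (Finset.mem_univ j)
  rcases mul_eq_zero.mp h0 with h | h
  · exact absurd h (Real.rpow_pos_of_pos (hr j).1 D).ne'
  · exact (Real.cos_eq_one_iff _).mp (by linarith)

lemma ofReal_mem_moranSet {N : ℕ} {r : Fin N → ℝ} (hr : ∀ j, 0 ≤ r j) {D : ℝ}
    (hD : ∑ j, r j ^ D = 1) : (D : ℂ) ∈ MoranSet r := by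
  change ∑ j, (r j : ℂ) ^ (D : ℂ) = 1
  rw [← Complex.ofReal_one, ← hD, Complex.ofReal_sum]
  exact Finset.sum_congr rfl fun j _ => (Complex.ofReal_cpow (hr j) D).symm

/-- Arbitrarily close to the critical line there are nonreal solutions of the Moran equation. -/
lemma exists_mem_moranSet_re_gt {N : ℕ} (hN : 0 < N) {r : Fin N → ℝ}
    (hr : ∀ j, r j ∈ Set.Ioo (0 : ℝ) 1) {D : ℝ} (hD : ∑ j, r j ^ D = 1) {ε : ℝ} (hε : 0 < ε) :
    ∃ ω ∈ MoranSet r, ω.im ≠ 0 ∧ D - ε < ω.re := by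
  have hr0 (j) : (r j : ℂ) ≠ 0 := by exact_mod_cast (hr j).1.ne'
  let F : ℂ → ℂ := fun s => ∑ j, (r j : ℂ) ^ s
  have hFD : F D = 1 := ofReal_mem_moranSet (fun j => (hr j).1.le) hD
  have hFdiff : Differentiable ℂ F := by
    intro s
    exact DifferentiableAt.fun_sum fun j _ => differentiableAt_id.const_cpow (Or.inl (hr0 j))
  have hanti {x y : ℝ} (hxy : x < y) : ∑ j, r j ^ y < ∑ j, r j ^ x :=
    Finset.sum_lt_sum_of_nonempty ⟨⟨0, hN⟩, Finset.mem_univ _⟩ fun j _ =>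
      Real.rpow_lt_rpow_of_exponent_gt (hr j).1 (hr j).2 hxy
  have hisol : ∀ᶠ z in 𝓝[≠] (D : ℂ), F z ≠ 1 := by
    refine ((hFdiff.analyticAt D).eventually_eq_or_eventually_ne analyticAt_const).resolve_left
      fun h => ?_
    have hconst := AnalyticOnNhd.eq_of_eventuallyEq
      (fun z _ => hFdiff.analyticAt z) (fun z _ => analyticAt_const) h
    have h1 : ((D + 1 : ℝ) : ℂ) ∈ MoranSet r := congrFun hconst _
    have := re_le_of_mem_moranSet hN hr hD h1
    rw [Complex.ofReal_re] at this
    linarith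
  rw [eventually_nhdsWithin_iff, Metric.eventually_nhds_iff] at hisol
  obtain ⟨δ₀, hδ₀, hne⟩ := hisol
  obtain ⟨δ, hδ, hδlt⟩ : ∃ δ, 0 < δ ∧ δ < min δ₀ (min ε 1) :=
    exists_between (lt_min hδ₀ (lt_min hε one_pos))
  have hδδ₀ : δ < δ₀ := hδlt.trans_le (min_le_left _ _)
  have hδε : δ < ε := hδlt.trans_le ((min_le_right _ _).trans (min_le_left _ _))
  have hδ1 : δ < 1 := hδlt.trans_le ((min_le_right _ _).trans (min_le_right _ _))
  obtain ⟨m, hm, hmF⟩ : ∃ m, 0 < m ∧ ∀ z ∈ Metric.sphere (D : ℂ) δ, m ≤ ‖F z - 1‖ := by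
    obtain ⟨z₀, hz₀, hmin⟩ := (isCompact_sphere (D : ℂ) δ).exists_isMinOn
      (NormedSpace.sphere_nonempty.mpr hδ.le)
      ((hFdiff.continuous.sub continuous_const).norm.continuousOn (f := fun z => ‖F z - 1‖))
    refine ⟨‖F z₀ - 1‖, norm_pos_iff.mpr (sub_ne_zero.mpr (hne ?_ ?_)), fun z hz => hmin hz⟩
    · rw [Metric.mem_sphere.mp hz₀]; exact hδδ₀
    · exact Metric.ne_of_mem_sphere hz₀ hδ.ne'
  set C := ∑ j, r j ^ (D - 1) with hC
  have hC0 : 0 < C := by linarith [hanti (sub_one_lt D)]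
  obtain ⟨t, ht, hclose⟩ := exists_one_le_forall_norm_cpow_mul_I_sub_one_lt
    (fun j => (hr j).1) (show 0 < m / (8 * C) by positivity)
  have hFclose {z : ℂ} (hz : z ∈ Metric.closedBall (D : ℂ) δ) :
      ‖F (z + t * Complex.I) - F z‖ ≤ m / 8 := by
    have hzre : D - 1 ≤ z.re := by
      have h1 := (Complex.abs_re_le_norm (z - D)).trans (mem_closedBall_iff_norm.mp hz)
      rw [Complex.sub_re, Complex.ofReal_re] at h1
      linarith [(abs_le.mp h1).1]
    calc ‖F (z + t * Complex.I) - F z‖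
        = ‖∑ j, (r j : ℂ) ^ z * ((r j : ℂ) ^ (t * Complex.I) - 1)‖ := by
          simp only [F, ← Finset.sum_sub_distrib]
          congr 1
          refine Finset.sum_congr rfl fun j _ => ?_
          rw [Complex.cpow_add _ _ (hr0 j)]
          ring
      _ ≤ ∑ j, r j ^ (D - 1) * (m / (8 * C)) := by
          refine norm_sum_le_of_le _ fun j _ => ?_
          rw [norm_mul, Complex.norm_cpow_eq_rpow_re_of_pos (hr j).1]
          exact mul_le_mul (Real.rpow_le_rpow_of_exponent_ge (hr j).1 (hr j).2.le hzre)
            (hclose j).le (norm_nonneg _) (Real.rpow_nonneg (hr j).1.le _)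
      _ = m / 8 := by
          rw [← Finset.sum_mul, ← hC]
          field_simp
  let G : ℂ → ℂ := fun z => F (z + t * Complex.I)
  have hGdiff : Differentiable ℂ G := hFdiff.comp (differentiable_id.add_const _)
  have hGD : ‖G D - 1‖ ≤ m / 8 := by
    simpa only [hFD] using hFclose (Metric.mem_closedBall_self hδ.le)
  have hGsphere : ∀ z ∈ Metric.sphere (D : ℂ) δ, m / 2 ≤ ‖G z - G D‖ := by
    intro z hz
    have h1 := hmF z hz
    have h2 : ‖G z - F z‖ ≤ m / 8 := hFclose (Metric.sphere_subset_closedBall hz)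
    have h3 : ‖F z - 1‖ ≤ ‖G z - G D‖ + ‖G D - 1‖ + ‖G z - F z‖ := by
      rw [show F z - 1 = (G z - G D) + (G D - 1) - (G z - F z) by ring]
      exact (norm_sub_le _ _).trans (by gcongr; exact norm_add_le _ _)
    linarith
  have hGfreq : ∃ᶠ z in 𝓝 (D : ℂ), G z ≠ G D := by
    intro h
    have hconst := AnalyticOnNhd.eq_of_eventuallyEq (g := fun _ => G D)
      (fun z _ => hGdiff.analyticAt z) (fun z _ => analyticAt_const)
      (h.mono fun z hz => not_not.mp hz)
    obtain ⟨z, hz⟩ := (NormedSpace.sphere_nonempty (x := (D : ℂ))).mpr hδ.le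
    have h1 := hGsphere z hz
    rw [congrFun hconst z, sub_self, norm_zero] at h1
    linarith
  have hmem : (1 : ℂ) ∈ Metric.ball (G D) (m / 2 / 2) := by
    rw [mem_ball_iff_norm, norm_sub_rev]
    linarith
  obtain ⟨z, hz, hGz⟩ :=
    hGdiff.diffContOnCl.ball_subset_image_closedBall hδ hGsphere hGfreq hmem
  have hzD := mem_closedBall_iff_norm.mp hz
  refine ⟨z + t * Complex.I, hGz, ?_, ?_⟩
  · have h1 := (Complex.abs_im_le_norm (z - D)).trans hzD
    rw [Complex.sub_im, Complex.ofReal_im] at h1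
    have : (z + t * Complex.I).im = z.im + t := by simp
    rw [this]
    linarith [(abs_le.mp h1).1]
  · have h1 := (Complex.abs_re_le_norm (z - D)).trans hzD
    rw [Complex.sub_re, Complex.ofReal_re] at h1
    have : (z + t * Complex.I).re = z.re := by simp
    rw [this]
    linarith [(abs_le.mp h1).1]

/-- For a nonlattice scaling vector `r` with similarity dimension `D`: `D ∈ S_r`, every other
element of `S_r` has real part strictly less than `D`, and there is a sequence of elements of
`S_r` whose real parts are less than `D` and tend to `D`. -/
theorem stmt8 {N : ℕ} (hN : 2 ≤ N) (r : Fin N → ℝ)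
    (hr : ∀ j, r j ∈ Set.Ioo (0 : ℝ) 1) (hnl : ¬ IsLatticeVec r)
    (D : ℝ) (hD : ∑ j, r j ^ D = 1) :
    ((D : ℂ) ∈ MoranSet r) ∧
    (∀ ω ∈ MoranSet r, ω ≠ (D : ℂ) → ω.re < D) ∧
    ∃ ω : ℕ → ℂ, (∀ n, ω n ∈ MoranSet r ∧ (ω n).re < D) ∧
      Tendsto (fun n => (ω n).re) atTop (𝓝 D) := by
  have hN0 : 0 < N := by omega
  have hlt {ω : ℂ} (hω : ω ∈ MoranSet r) (him : ω.im ≠ 0) : ω.re < D :=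
    (re_le_of_mem_moranSet hN0 hr hD hω).lt_of_ne fun hre =>
      hnl (isLatticeVec_of_mem_moranSet hN0 hr hD hω hre him)
  refine ⟨ofReal_mem_moranSet (fun j => (hr j).1.le) hD, fun ω hω hne => ?_, ?_⟩
  · refine (re_le_of_mem_moranSet hN0 hr hD hω).lt_of_ne fun hre => ?_
    by_cases him : ω.im = 0
    · exact hne (Complex.ext (by simpa using hre) (by simpa using him))
    · exact (hlt hω him).ne hre
  · choose ω hω him hre using fun n : ℕ =>
      exists_mem_moranSet_re_gt hN0 hr hD (Nat.one_div_pos_of_nat (α := ℝ) (n := n))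
    refine ⟨ω, fun n => ⟨hω n, hlt (hω n) (him n)⟩,
      tendsto_of_tendsto_of_tendsto_of_le_of_le ?_ tendsto_const_nhds
        (fun n => (hre n).le) fun n => (hlt (hω n) (him n)).le⟩
    simpa using (tendsto_const_nhds (x := D)).sub (tendsto_one_div_add_atTop_nhds_zero_nat (𝕜 := ℝ))
end
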